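/- Let G be a transitive subgroup of S_6 of order 120 that is not contained in the alternating group A_6 (the group 6T14, isomorphic to PGL_2(F_5)). Then for every ε > 0 there is a constant c(ε) such that for all X ≥ 2, F_6(X;G) ≤ c(ε) · X^{E+ε}, where E = 2 − 1 − 1/10 + √(6/120) + 6/20 = 9/10 + √(1/20) + 3/10. -/

import Mathlib

open Polynomial

noncomputable section

/-- A fixed algebraic closure of `ℚ`. -/
abbrev Qbar : Type := AlgebraicClosure ℚ

/-- The discriminant of a subfield of `ℚ̄` (zero if it is not a number field). -/
def fieldDiscr (K : IntermediateField ℚ Qbar) : ℤ := by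
  by_cases h : FiniteDimensional ℚ K
  · exact @NumberField.discr K _ ⟨⟩
  · exact 0

/-- The action of `Gal(ℚ̄/ℚ)` on the embeddings of `K` into `ℚ̄`; its image is the
Galois group of the Galois closure of `K`, acting on the embeddings of `K`. -/
def galAct (K : IntermediateField ℚ Qbar) :
    (Qbar ≃ₐ[ℚ] Qbar) →* Equiv.Perm (K →ₐ[ℚ] Qbar) where
  toFun σ :=
    { toFun := fun ι => σ.toAlgHom.comp ι
      invFun := fun ι => σ.symm.toAlgHom.comp ι
      left_inv := fun ι => by ext x; simp
      right_inv := fun ι => by ext x; simp }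
  map_one' := by
    apply Equiv.ext; intro ι; ext x; simp
  map_mul' := fun σ τ => by
    apply Equiv.ext; intro ι; ext x; simp

/-- `K` has Galois group (of its Galois closure, acting on the `n` embeddings of `K` in `ℚ̄`)
equal to `G`, up to conjugacy; this is encoded by an identification of the embeddings
with `Fin n` under which the image of the Galois action is exactly `G`. -/
def HasGalGroup (n : ℕ) (K : IntermediateField ℚ Qbar)
    (G : Subgroup (Equiv.Perm (Fin n))) : Prop :=
  ∃ e : (K →ₐ[ℚ] Qbar) ≃ Fin n, ∀ σ : Equiv.Perm (Fin n),
    σ ∈ G ↔ ∃ g : Qbar ≃ₐ[ℚ] Qbar, Equiv.permCongr e (galAct K g) = σ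

/-- The number of number fields of degree `n`, absolute discriminant at most `X`,
and Galois group (as a permutation group on the embeddings) conjugate to `G`. -/
def FnG (n : ℕ) (X : ℝ) (G : Subgroup (Equiv.Perm (Fin n))) : ℕ :=
  Nat.card {K : IntermediateField ℚ Qbar //
    Module.finrank ℚ K = n ∧ |(fieldDiscr K : ℝ)| ≤ X ∧ HasGalGroup n K G}

/-- The number of number fields of degree `n` and absolute discriminant at most `X`. -/
def FnAll (n : ℕ) (X : ℝ) : ℕ :=
  Nat.card {K : IntermediateField ℚ Qbar //
    Module.finrank ℚ K = n ∧ |(fieldDiscr K : ℝ)| ≤ X}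

/-- A subgroup of the permutations of `β` is transitive. -/
def IsTransitiveSub {β : Type*} (G : Subgroup (Equiv.Perm β)) : Prop :=
  ∀ x y : β, ∃ σ ∈ G, σ x = y

/-- `G` admits a nontrivial block system: a partition of `β` into `k ≥ 2` nonempty parts,
some part having at least two elements, whose parts are permuted by every element of `G`. -/
def HasBlockSystem {β : Type*} (G : Subgroup (Equiv.Perm β)) : Prop :=
  ∃ (k : ℕ) (R : Fin k → Set β), 2 ≤ k ∧
    (∀ j, (R j).Nonempty) ∧
    (∃ j, 2 ≤ Nat.card (R j)) ∧
    (∀ x : β, ∃! j, x ∈ R j) ∧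
    (∀ σ ∈ G, ∀ i, ∃ j, (fun x => σ x) '' R i = R j)

/-- An imprimitive permutation group: transitive with a nontrivial block system. -/
def IsImprimitiveSub {β : Type*} (G : Subgroup (Equiv.Perm β)) : Prop :=
  IsTransitiveSub G ∧ HasBlockSystem G

/-- A primitive permutation group: transitive with no nontrivial block system. -/
def IsPrimitiveSub {β : Type*} (G : Subgroup (Equiv.Perm β)) : Prop :=
  IsTransitiveSub G ∧ ¬ HasBlockSystem G

end

section GroupTheory

open scoped Pointwise

open MulAction Equiv.Perm

variable {G : Subgroup (Equiv.Perm (Fin 6))}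

theorem isPreprimitive_of_card_eq (htrans : ∀ x y, ∃ σ ∈ G, σ x = y) (hcard : Nat.card G = 120) :
    IsPreprimitive G (Fin 6) := by
  have : Fact (Nat.Prime 5) := ⟨by norm_num⟩
  obtain ⟨⟨g, hgG⟩, hg⟩ := exists_prime_orderOf_dvd_card' (G := G) 5 (by rw [hcard]; norm_num)
  rw [Subgroup.orderOf_mk] at hg
  have hc : g.IsCycle := isCycle_of_prime_order' (by rw [hg]; norm_num) (by rw [hg]; simp)
  have hsupp : g.support.card = 5 := by rw [← hc.orderOf, hg]
  obtain ⟨a, ha⟩ : ∃ a, a ∉ g.support := by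
    by_contra! h
    rw [Finset.eq_univ_iff_forall.mpr h] at hsupp
    simp at hsupp
  have huniv : ∀ x, x ≠ a → x ∈ g.support := by
    intro x hx
    by_contra hx'
    have : g.support ⊆ (Finset.univ.erase a).erase x := fun y hy =>
      Finset.mem_erase.mpr ⟨fun h => hx' (h ▸ hy), Finset.mem_erase.mpr
        ⟨fun h => ha (h ▸ hy), Finset.mem_univ _⟩⟩
    have := Finset.card_le_card this
    rw [Finset.card_erase_of_mem (by simp [hx]), Finset.card_erase_of_mem (by simp)] at this
    simp [hsupp] at this
  have : IsPretransitive G (Fin 6) := ⟨fun x y => by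
    obtain ⟨σ, hσ, h⟩ := htrans x y
    exact ⟨⟨σ, hσ⟩, h⟩⟩
  refine IsPreprimitive.of_isTrivialBlock_base a fun {B} haB hB => ?_
  by_cases hs : B.Subsingleton
  · exact Or.inl hs
  · right
    obtain ⟨b, hbB, hba⟩ : ∃ b ∈ B, b ≠ a := by
      by_contra! h
      exact hs fun x hx y hy => (h x hx).trans (h y hy).symm
    refine Set.eq_univ_of_forall fun x => ?_
    by_cases hxa : x = a
    · rwa [hxa]
    obtain ⟨i, hi⟩ := hc.exists_zpow_eq (mem_support.mp (huniv b hba))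
      (mem_support.mp (huniv x hxa))
    have h1 : ((⟨g, hgG⟩ : G) ^ i) • B = B := by
      refine hB.smul_eq_of_mem haB ?_
      have : (g ^ i) a = a := zpow_apply_eq_self_of_apply_eq_self (notMem_support.mp ha) i
      change (g ^ i) a ∈ B
      rwa [this]
    rw [← h1]
    exact ⟨b, hbB, hi⟩

theorem not_isSwap_of_mem (htrans : ∀ x y, ∃ σ ∈ G, σ x = y) (hcard : Nat.card G = 120)
    {g : Equiv.Perm (Fin 6)} (hg : g ∈ G) : ¬ g.IsSwap := by
  intro h
  have := subgroup_eq_top_of_isPreprimitive_of_isSwap_mem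
    (isPreprimitive_of_card_eq htrans hcard) g h hg
  rw [this, Subgroup.card_top, Nat.card_perm] at hcard
  simp [Nat.factorial] at hcard

theorem not_isThreeCycle_of_mem (htrans : ∀ x y, ∃ σ ∈ G, σ x = y) (hcard : Nat.card G = 120)
    {g : Equiv.Perm (Fin 6)} (hg : g ∈ G) : ¬ g.IsThreeCycle := by
  intro h
  have := Subgroup.card_le_of_le (alternatingGroup_le_of_isPreprimitive_of_isThreeCycle_mem
    (isPreprimitive_of_card_eq htrans hcard) h hg)
  rw [hcard, nat_card_alternatingGroup] at this
  simp [Nat.factorial] at this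

theorem normalCore_eq_bot_of_card_eq (hcard : Nat.card G = 120) : G.normalCore = ⊥ := by
  have hs : IsSimpleGroup (alternatingGroup (Fin 6)) := alternatingGroup.isSimpleGroup (by simp)
  have hA : Nat.card (alternatingGroup (Fin 6)) = 360 := by
    rw [nat_card_alternatingGroup]; simp [Nat.factorial]
  have hcore : G.normalCore ⊓ alternatingGroup (Fin 6) = ⊥ := by
    rcases (Subgroup.Normal.subgroupOf G.normalCore_normal
      (alternatingGroup (Fin 6))).eq_bot_or_eq_top with h | h
    · rwa [Subgroup.subgroupOf_eq_bot, disjoint_iff] at h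
    · rw [Subgroup.subgroupOf_eq_top] at h
      have := Subgroup.card_le_of_le (h.trans G.normalCore_le)
      omega
  rw [eq_bot_iff]
  intro x hx
  rw [Subgroup.mem_bot]
  by_contra hx1
  have hconj : ∀ g, g * x * g⁻¹ = x := by
    intro g
    have h1 : g * x * g⁻¹ * x⁻¹ ∈ G.normalCore ⊓ alternatingGroup (Fin 6) :=
      Subgroup.mem_inf.mpr ⟨mul_mem (G.normalCore_normal.conj_mem x hx g) (inv_mem hx), by
        rw [mem_alternatingGroup]
        rcases Int.units_eq_one_or (sign x) with h | h <;>
        rcases Int.units_eq_one_or (sign g) with h' | h' <;> simp [h, h']⟩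
    rw [hcore, Subgroup.mem_bot] at h1
    exact mul_inv_eq_one.mp h1
  obtain ⟨a, ha⟩ : ∃ a, x a ≠ a := by
    by_contra! h
    exact hx1 (Equiv.ext h)
  obtain ⟨c, hc⟩ := Finset.exists_mem_notMem_of_card_lt_card
    (s := {a, x a}) (t := Finset.univ) (Finset.card_le_two.trans_lt (by simp))
  simp only [Finset.mem_univ, Finset.mem_insert, Finset.mem_singleton, not_or, true_and] at hc
  have h := DFunLike.congr_fun (mul_inv_eq_iff_eq_mul.mp (hconj (Equiv.swap (x a) c))) a
  rw [mul_apply, mul_apply, Equiv.swap_apply_left, Equiv.swap_apply_of_ne_of_ne (Ne.symm ha)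
    (Ne.symm hc.1)] at h
  exact hc.2 h

/-- The action of permutations of six letters on the cosets of a subgroup of index six. -/
noncomputable def cosetHom (e : (Equiv.Perm (Fin 6) ⧸ G) ≃ Fin 6) :
    Equiv.Perm (Fin 6) →* Equiv.Perm (Fin 6) :=
  e.permCongrHom.toMonoidHom.comp (toPermHom (Equiv.Perm (Fin 6)) (Equiv.Perm (Fin 6) ⧸ G))

theorem cosetHom_apply (e : (Equiv.Perm (Fin 6) ⧸ G) ≃ Fin 6) (g : Equiv.Perm (Fin 6)) (x : Fin 6) :
    cosetHom e g x = e (g • e.symm x) := rfl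

theorem cosetHom_bijective (hcard : Nat.card G = 120) (e : (Equiv.Perm (Fin 6) ⧸ G) ≃ Fin 6) :
    Function.Bijective (cosetHom e) := by
  refine Finite.injective_iff_bijective.mp ?_
  refine e.permCongrHom.injective.comp ?_
  change Function.Injective (toPermHom (Equiv.Perm (Fin 6)) (Equiv.Perm (Fin 6) ⧸ G))
  rw [← MonoidHom.ker_eq_bot_iff, ← Subgroup.normalCore_eq_ker, normalCore_eq_bot_of_card_eq hcard]

theorem sign_cosetHom (hcard : Nat.card G = 120) (e : (Equiv.Perm (Fin 6) ⧸ G) ≃ Fin 6)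
    (g : Equiv.Perm (Fin 6)) : sign (cosetHom e g) = sign g := by
  have h := eq_sign_of_surjective_hom (s := sign.comp (cosetHom e))
    (by
      rw [MonoidHom.coe_comp]
      exact (sign_surjective (Fin 6)).comp (cosetHom_bijective hcard e).2)
  exact DFunLike.congr_fun h g

theorem cosetHom_apply_eq_self_iff (e : (Equiv.Perm (Fin 6) ⧸ G) ≃ Fin 6)
    (g : Equiv.Perm (Fin 6)) :
    cosetHom e g (e (QuotientGroup.mk 1)) = e (QuotientGroup.mk 1) ↔ g ∈ G := by
  rw [cosetHom_apply, Equiv.symm_apply_apply, e.apply_eq_iff_eq, ← mem_stabilizer_iff,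
    stabilizer_quotient]

theorem pow_four_eq_one_of_card_support {σ : Equiv.Perm (Fin 6)} (h : σ.support.card = 4) :
    σ ^ 4 = 1 := by
  rw [← orderOf_dvd_iff_pow_eq_one, ← lcm_cycleType, Multiset.lcm_dvd]
  intro n hn
  have h2 := two_le_of_mem_cycleType hn
  obtain ⟨t, ht⟩ := Multiset.exists_cons_of_mem hn
  have hs := sum_cycleType σ
  rw [ht, Multiset.sum_cons, h] at hs
  have h3 : n ≠ 3 := by
    rintro rfl
    have h1 : t.sum = 1 := by omega
    rcases Multiset.empty_or_exists_mem t with rfl | ⟨m, hm⟩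
    · simp at h1
    · have := Multiset.le_sum_of_mem hm
      have := two_le_of_mem_cycleType (σ := σ) (n := m) (by rw [ht]; simp [hm])
      omega
  have : n ≤ 4 := by omega
  interval_cases n <;> simp_all

theorem card_support_eq_six_of_sq_eq_one {σ : Equiv.Perm (Fin 6)} (h : σ ^ 2 = 1)
    (hs : sign σ = -1) (hn : ¬ σ.IsSwap) : σ.support.card = 6 := by
  have h2 : ∀ n ∈ σ.cycleType, n = 2 := by
    intro n hn
    have h1 := two_le_of_mem_cycleType hn
    have := Nat.le_of_dvd (by norm_num)
      ((dvd_of_mem_cycleType hn).trans (orderOf_dvd_of_pow_eq_one h))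
    omega
  have h3 := Multiset.eq_replicate_card.mpr h2
  have h4 := sum_cycleType σ
  have h5 := sign_of_cycleType σ
  have h6 := σ.support.card_le_univ
  rw [Fintype.card_fin] at h6
  rw [← Equiv.Perm.card_support_eq_two] at hn
  set k := σ.cycleType.card
  rw [h3, Multiset.sum_replicate, smul_eq_mul] at h4
  rw [hs, sum_cycleType, ← h4] at h5
  have : k ≤ 3 := by omega
  interval_cases k
  · simp at h5
  · omega
  · simp [pow_succ] at h5
  · omega

/-- A transitive subgroup of order `120` of the permutations of six letters acts on five letters
as the full symmetric group. -/
theorem exists_hom_perm_fin_five (htrans : ∀ x y, ∃ σ ∈ G, σ x = y) (hcard : Nat.card G = 120) :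
    ∃ ψ : G →* Equiv.Perm (Fin 5), Function.Bijective ψ ∧
      (∀ h : G, (ψ h).support.card ≤ (h : Equiv.Perm (Fin 6)).support.card) ∧
      ∀ h : G, (ψ h).support.card = 2 → (h : Equiv.Perm (Fin 6)).support.card = 6 := by
  classical
  have hidx : Nat.card (Equiv.Perm (Fin 6) ⧸ G) = 6 := by
    have := Subgroup.card_eq_card_quotient_mul_card_subgroup G
    rw [hcard, Nat.card_perm, Nat.card_fin] at this
    simp only [Nat.factorial] at this
    omega
  have e : (Equiv.Perm (Fin 6) ⧸ G) ≃ Fin 6 := Finite.equivFinOfCardEq hidx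
  set b := e (QuotientGroup.mk 1) with hb
  have e' : {x : Fin 6 // x ≠ b} ≃ Fin 5 := Fintype.equivFinOfCardEq (by simp)
  have hfix : ∀ h : G, cosetHom e h b = b := fun h => (cosetHom_apply_eq_self_iff e _).mpr h.2
  have hiff : ∀ (h : G) (x : Fin 6), cosetHom e h x ≠ b ↔ x ≠ b := fun h x => not_congr
    ⟨fun h' => (cosetHom e h).injective (h'.trans (hfix h).symm), fun h' => h' ▸ hfix h⟩
  let ψ₀ : G →* Equiv.Perm {x : Fin 6 // x ≠ b} :=
    { toFun := fun h => (cosetHom e h).subtypePerm (hiff h)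
      map_one' := by ext; simp
      map_mul' := fun x y => by ext; simp only [Subgroup.coe_mul, map_mul]; rfl }
  have hψ₀ : ∀ h, ofSubtype (ψ₀ h) = cosetHom e h := fun h =>
    ofSubtype_subtypePerm (hiff h) fun x hx hxb => hx (hxb ▸ hfix h)
  have hinj₀ : Function.Injective ψ₀ := fun x y hxy =>
    Subtype.ext ((cosetHom_bijective hcard e).1 (by rw [← hψ₀, ← hψ₀, hxy]))
  let ψ : G →* Equiv.Perm (Fin 5) := e'.permCongrHom.toMonoidHom.comp ψ₀
  have hsupp : ∀ h, (ψ h).support.card = (cosetHom e h).support.card := by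
    intro h
    rw [← hψ₀, support_ofSubtype, Finset.card_map]
    change (e'.permCongr (ψ₀ h)).support.card = _
    refine (Finset.card_bij (fun x _ => e' x) ?_ ?_ ?_).symm
    · intro x hx; simpa using hx
    · intro x _ y _ hxy; exact e'.injective hxy
    · intro y hy
      refine ⟨e'.symm y, ?_, by simp⟩
      rw [mem_support] at hy ⊢
      contrapose! hy
      rw [Equiv.permCongr_apply, hy, Equiv.apply_symm_apply]
  have hinj : Function.Injective ψ := e'.permCongrHom.injective.comp hinj₀
  have hsign : ∀ h, sign (ψ h) = sign (h : Equiv.Perm (Fin 6)) := by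
    intro h
    rw [← sign_cosetHom hcard e, ← hψ₀, sign_ofSubtype]
    exact sign_permCongr e' _
  refine ⟨ψ, ?_, fun h => ?_, fun h hh => ?_⟩
  · refine (Nat.bijective_iff_injective_and_card ψ).mpr ⟨hinj, ?_⟩
    rw [hcard, Nat.card_perm]; simp [Nat.factorial]
  · by_contra! hlt
    have h5 := (ψ h).support.card_le_univ
    rw [Fintype.card_fin] at h5
    have h1 : (h : Equiv.Perm (Fin 6)).support.card ≠ 1 := card_support_ne_one _
    have h0 : (h : Equiv.Perm (Fin 6)).support.card ≠ 0 := by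
      intro h0
      rw [Finset.card_eq_zero, support_eq_empty_iff] at h0
      rw [show h = 1 from Subtype.ext h0, map_one] at hlt
      simp at hlt
    have h2 := Equiv.Perm.card_support_eq_two.not.mpr (not_isSwap_of_mem htrans hcard h.2)
    have h3 := card_support_eq_three_iff.not.mpr (not_isThreeCycle_of_mem htrans hcard h.2)
    have h4 : (h : Equiv.Perm (Fin 6)).support.card = 4 := by omega
    have hp : h ^ 4 = 1 := Subtype.ext (pow_four_eq_one_of_card_support h4)
    have : Fact (Nat.Prime 2) := ⟨Nat.prime_two⟩
    obtain ⟨a, ha⟩ :=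
      exists_fixed_point_of_prime (α := Fin 5) (p := 2) (n := 2) (σ := ψ h) (by simp)
      (by rw [← map_pow]; norm_num [hp])
    have h5' : (ψ h).support = Finset.univ := by
      rw [← Finset.card_eq_iff_eq_univ, Fintype.card_fin]; omega
    exact mem_support.mp (h5' ▸ Finset.mem_univ a) ha
  · have hsw := Equiv.Perm.card_support_eq_two.mp hh
    refine card_support_eq_six_of_sq_eq_one ?_ ?_ (not_isSwap_of_mem htrans hcard h.2)
    · have : h ^ 2 = 1 := by
        apply hinj
        obtain ⟨x, y, _, hxy⟩ := hsw
        rw [map_pow, hxy, map_one, sq, Equiv.swap_mul_self]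
      exact congrArg Subtype.val this
    · rw [← hsign]; exact hsw.sign_eq

end GroupTheory

section LocalTheory

open NumberField Ideal Pointwise

variable {N : Type*} [Field N] [NumberField N] [IsGalois ℚ N] {p : ℕ} [hp : Fact p.Prime]

theorem span_prime_ne_bot : (span {(p : ℤ)} : Ideal ℤ) ≠ ⊥ := by
  simpa using hp.out.ne_zero

instance span_prime_isMaximal : (span {(p : ℤ)} : Ideal ℤ).IsMaximal :=
  PrincipalIdealRing.isMaximal_of_irreducible
    (Nat.prime_iff_prime_int.mp hp.out).irreducible

variable (P : Ideal (𝓞 N)) [P.IsPrime] [hP : P.LiesOver (span {(p : ℤ)})]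

/-- The finite set of primes of the ring of integers of `N` above the rational prime `p`. -/
noncomputable def primesAbove (p : ℕ) (N : Type*) [Field N] [NumberField N] :
    Finset (Ideal (𝓞 N)) :=
  IsDedekindDomain.primesOverFinset (span {(p : ℤ)}) (𝓞 N)

omit [IsGalois ℚ N] in
theorem mem_primesAbove {Q : Ideal (𝓞 N)} : Q ∈ primesAbove p N ↔
    Q.IsPrime ∧ Q.LiesOver (span {(p : ℤ)}) :=
  IsDedekindDomain.mem_primesOverFinset_iff span_prime_ne_bot _

include hP in
theorem sum_galois_smul {M : Type*} [AddCommMonoid M] (F : Ideal (𝓞 N) → M) :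
    ∑ σ : Gal(N/ℚ), F (σ • P) = Nat.card (MulAction.stabilizer Gal(N/ℚ) P) •
      ∑ Q ∈ primesAbove p N, F Q := by
  classical
  rw [← Finset.sum_fiberwise_of_maps_to (t := primesAbove p N)
    (g := fun σ : Gal(N/ℚ) => σ • P), Finset.smul_sum]
  · refine Finset.sum_congr rfl fun Q hQ => ?_
    rw [mem_primesAbove] at hQ
    obtain ⟨hQ1, hQ2⟩ := hQ
    obtain ⟨τ, rfl⟩ := exists_smul_eq_of_isGaloisGroup (span {(p : ℤ)}) P Q Gal(N/ℚ)
    rw [Finset.sum_congr rfl (g := fun _ => F (τ • P)), Finset.sum_const]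
    · congr 1
      have hinj : Function.Injective
          (fun x : MulAction.stabilizer Gal(N/ℚ) P => τ * (x : Gal(N/ℚ))) :=
        fun x y h => Subtype.ext (mul_left_cancel h)
      rw [Nat.card_eq_fintype_card, ← Finset.card_univ, ← Finset.card_image_of_injective _ hinj]
      congr 1
      ext σ
      simp only [Finset.mem_filter, Finset.mem_univ, true_and, Finset.mem_image, Subtype.exists,
        MulAction.mem_stabilizer_iff]
      constructor
      · intro h
        exact ⟨τ⁻¹ * σ, by rw [mul_smul, h, inv_smul_smul], by simp⟩
      · rintro ⟨x, hx, rfl⟩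
        rw [mul_smul, hx]
    · intro σ hσ
      rw [(Finset.mem_filter.mp hσ).2]
  · intro σ _
    rw [mem_primesAbove]
    exact ⟨inferInstance, inferInstance⟩

include hP in
theorem natCard_inertia_eq_ramificationIdx :
    Nat.card (P.inertia Gal(N/ℚ)) = P.ramificationIdx ℤ := by
  rw [card_inertia_eq_ramificationIdxIn (span {(p : ℤ)}) P,
    ramificationIdxIn_eq_ramificationIdx (span {(p : ℤ)}) P Gal(N/ℚ)]

include hP in
theorem natCard_stabilizer_eq_inertia_mul :
    Nat.card (MulAction.stabilizer Gal(N/ℚ) P) =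
      Nat.card (P.inertia Gal(N/ℚ)) * (span {(p : ℤ)}).inertiaDegIn (𝓞 N) := by
  rw [card_stabilizer_eq (span {(p : ℤ)}) P, card_inertia_eq_ramificationIdxIn (span {(p : ℤ)}) P]
omit [IsGalois ℚ N] in
theorem mem_differentIdeal_int_iff {x : 𝓞 N} :
    x ∈ differentIdeal ℤ (𝓞 N) ↔ ∀ y : N, (∀ a : 𝓞 N, ∃ n : ℤ, Algebra.trace ℚ N (y * a) = n) →
      ∃ b : 𝓞 N, (x : N) * y = b := by
  have h := coeSubmodule_differentIdeal ℤ ℚ (L := N) (𝓞 N)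
  have h1 : x ∈ differentIdeal ℤ (𝓞 N) ↔
      (x : N) ∈ IsLocalization.coeSubmodule N (differentIdeal ℤ (𝓞 N)) := by
    rw [IsLocalization.mem_coeSubmodule]
    constructor
    · exact fun h => ⟨x, h, rfl⟩
    · rintro ⟨y, hy, hxy⟩
      rwa [← RingOfIntegers.coe_injective hxy]
  rw [h1, h, Submodule.mem_div_iff_forall_mul_mem]
  refine forall_congr' fun y => ?_
  simp only [Submodule.mem_traceDual, Submodule.mem_one, RingHom.mem_range, Algebra.traceForm_apply]
  constructor
  · intro h1 h2
    obtain ⟨b, hb⟩ := h1 (by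
      rintro a ⟨a, rfl⟩
      obtain ⟨n, hn⟩ := h2 a
      exact ⟨n, by rw [hn]; simp⟩)
    exact ⟨b, hb.symm⟩
  · intro h1 h2
    obtain ⟨b, hb⟩ := h1 (by
      intro a
      obtain ⟨n, hn⟩ := h2 a ⟨a, rfl⟩
      exact ⟨n, by rw [← hn]; simp⟩)
    exact ⟨b, hb.symm⟩

omit [IsGalois ℚ N] in
theorem smul_mem_differentIdeal_int (σ : Gal(N/ℚ)) {x : 𝓞 N} (hx : x ∈ differentIdeal ℤ (𝓞 N)) :
    σ • x ∈ differentIdeal ℤ (𝓞 N) := by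
  rw [mem_differentIdeal_int_iff] at hx ⊢
  intro y hy
  obtain ⟨b, hb⟩ := hx (σ⁻¹ y) (by
    intro a
    obtain ⟨n, hn⟩ := hy (σ • a)
    refine ⟨n, ?_⟩
    rw [← hn, ← Algebra.trace_eq_of_algEquiv σ]
    congr 1
    rw [map_mul]
    congr 1
    exact AlgEquiv.apply_symm_apply σ y)
  refine ⟨σ • b, ?_⟩
  have := congrArg σ hb
  rw [map_mul] at this
  have h2 : σ (σ⁻¹ y) = y := AlgEquiv.apply_symm_apply σ y
  rw [h2] at this
  exact this

omit [IsGalois ℚ N] in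
theorem smul_differentIdeal_int (σ : Gal(N/ℚ)) :
    σ • differentIdeal ℤ (𝓞 N) = differentIdeal ℤ (𝓞 N) := by
  ext x
  rw [Ideal.mem_pointwise_smul_iff_inv_smul_mem]
  exact ⟨fun h => by simpa using smul_mem_differentIdeal_int σ h,
    fun h => smul_mem_differentIdeal_int σ⁻¹ h⟩

omit [IsGalois ℚ N] in
theorem pow_dvd_finrank_of_differentIdeal_le {t : ℕ}
    (ht : (span {(p : 𝓞 N)}) ^ t ∣ differentIdeal ℤ (𝓞 N)) :
    p ^ t ∣ Module.finrank ℚ N := by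
  have hp0 : (p : N) ≠ 0 := by exact_mod_cast hp.out.ne_zero
  have hI : span {(p : 𝓞 N)} ^ t ≠ ⊥ := by
    rw [span_singleton_pow]
    simpa using fun h => absurd h hp.out.ne_zero
  have h := (differentialIdeal_le_iff (A := ℤ) (K := ℚ) (L := N) hI).mp (Ideal.le_of_dvd ht)
  have hmem : ((p : N) ^ t)⁻¹ ∈ ((((span {(p : 𝓞 N)} ^ t : Ideal (𝓞 N)) :
      FractionalIdeal (nonZeroDivisors (𝓞 N)) N)⁻¹ : FractionalIdeal (nonZeroDivisors (𝓞 N)) N) :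
      Submodule (𝓞 N) N) := by
    rw [span_singleton_pow, FractionalIdeal.coeIdeal_span_singleton,
      FractionalIdeal.spanSingleton_inv]
    simp [FractionalIdeal.coe_spanSingleton, Submodule.mem_span_singleton_self]
  have h2 := h (Submodule.mem_map_of_mem (f := (Algebra.trace ℚ N).restrictScalars ℤ) hmem)
  rw [Submodule.mem_one] at h2
  obtain ⟨n, hn⟩ := h2
  have h3 : Algebra.trace ℚ N (((p : N) ^ t)⁻¹) = Module.finrank ℚ N • ((p : ℚ) ^ t)⁻¹ := by
    rw [← Algebra.trace_algebraMap]
    simp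
  have h4 : (n : ℚ) = Module.finrank ℚ N • ((p : ℚ) ^ t)⁻¹ := by
    rw [← h3]
    simpa using hn
  have hp0' : (p : ℚ) ^ t ≠ 0 := by exact_mod_cast pow_ne_zero _ hp.out.ne_zero
  have h5 : (n * p ^ t : ℤ) = Module.finrank ℚ N := by
    have : (n : ℚ) * p ^ t = Module.finrank ℚ N := by
      rw [h4, nsmul_eq_mul, mul_assoc, inv_mul_cancel₀ hp0', mul_one]
    exact_mod_cast this
  have : ((p ^ t : ℕ) : ℤ) ∣ (Module.finrank ℚ N : ℕ) := ⟨n, by rw [← h5]; push_cast; ring⟩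
  exact_mod_cast this
include hP in
theorem dvd_differentIdeal_of_mem_primesAbove {d : ℕ} (hd : P ^ d ∣ differentIdeal ℤ (𝓞 N))
    {Q : Ideal (𝓞 N)} (hQ : Q ∈ primesAbove p N) : Q ^ d ∣ differentIdeal ℤ (𝓞 N) := by
  rw [mem_primesAbove] at hQ
  obtain ⟨_, _⟩ := hQ
  obtain ⟨σ, rfl⟩ := exists_smul_eq_of_isGaloisGroup (span {(p : ℤ)}) P Q Gal(N/ℚ)
  rw [Ideal.dvd_iff_le] at hd ⊢
  rw [← smul_differentIdeal_int σ, ← smul_pow']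
  exact pointwise_smul_le_pointwise_smul_iff.mpr hd

omit [IsGalois ℚ N] in
theorem pairwise_isCoprime_pow_primesAbove (F : Ideal (𝓞 N) → ℕ) :
    (primesAbove p N : Set (Ideal (𝓞 N))).Pairwise
      (Function.onFun IsCoprime fun Q => Q ^ F Q) := by
  intro Q hQ Q' hQ' hne
  rw [Finset.mem_coe, mem_primesAbove] at hQ hQ'
  obtain ⟨_, _⟩ := hQ
  obtain ⟨_, _⟩ := hQ'
  have h1 : Q.IsMaximal := Ideal.IsMaximal.of_liesOver_isMaximal Q (span {(p : ℤ)})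
  have h2 : Q'.IsMaximal := Ideal.IsMaximal.of_liesOver_isMaximal Q' (span {(p : ℤ)})
  exact (Ideal.isCoprime_iff_sup_eq.mpr (h1.coprime_of_ne h2 hne)).pow

theorem absNorm_prod_primesAbove (F : Ideal (𝓞 N) → ℕ) :
    absNorm (∏ Q ∈ primesAbove p N, Q ^ F Q) =
      p ^ ((span {(p : ℤ)}).inertiaDegIn (𝓞 N) * ∑ Q ∈ primesAbove p N, F Q) := by
  rw [map_prod, Finset.mul_sum, ← Finset.prod_pow_eq_pow_sum]
  refine Finset.prod_congr rfl fun Q hQ => ?_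
  rw [mem_primesAbove] at hQ
  obtain ⟨_, _⟩ := hQ
  have h1 : Q.IsMaximal := Ideal.IsMaximal.of_liesOver_isMaximal Q (span {(p : ℤ)})
  rw [map_pow, absNorm_eq_pow_inertiaDeg' Q hp.out, inertiaDeg'_eq_inertiaDeg, ← pow_mul,
    inertiaDegIn_eq_inertiaDeg (span {(p : ℤ)}) Q Gal(N/ℚ)]

theorem prime_pow_sum_dvd_absNorm (F : Ideal (𝓞 N) → ℕ) (J : Ideal (𝓞 N))
    (h : ∀ Q ∈ primesAbove p N, Q ^ F Q ∣ J) :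
    p ^ ((span {(p : ℤ)}).inertiaDegIn (𝓞 N) * ∑ Q ∈ primesAbove p N, F Q) ∣ absNorm J := by
  rw [← absNorm_prod_primesAbove]
  exact map_dvd absNorm
    (Finset.prod_dvd_of_coprime (pairwise_isCoprime_pow_primesAbove F) h)

include hP in
theorem span_natCast_eq_prod_primesAbove :
    span {(p : 𝓞 N)} = ∏ Q ∈ primesAbove p N, Q ^ Nat.card (P.inertia Gal(N/ℚ)) := by
  have h := map_algebraMap_eq_finsetProd_pow (R := 𝓞 N) (p := span {(p : ℤ)}) span_prime_ne_bot
  rw [map_span, Set.image_singleton] at h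
  simp only [algebraMap_int_eq, eq_intCast, Int.cast_natCast] at h
  rw [h]
  have hset : ((span {(p : ℤ)}).primesOver (𝓞 N)).toFinset = primesAbove p N := by
    ext Q
    rw [Set.mem_toFinset, mem_primesAbove]
    rfl
  rw [hset]
  refine Finset.prod_congr rfl fun Q hQ => ?_
  rw [mem_primesAbove] at hQ
  obtain ⟨_, _⟩ := hQ
  rw [natCard_inertia_eq_ramificationIdx P (p := p),
    ramificationIdx_eq_of_isGaloisGroup (span {(p : ℤ)}) P Q Gal(N/ℚ)]

include hP in
theorem padicValNat_discr_le {t : ℕ} (ht : ¬ p ^ t ∣ Module.finrank ℚ N) :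
    padicValNat p (discr N).natAbs ≤ (span {(p : ℤ)}).inertiaDegIn (𝓞 N) *
      ((primesAbove p N).card * (Nat.card (P.inertia Gal(N/ℚ)) * t - 1)) := by
  set D := differentIdeal ℤ (𝓞 N) with hD
  have hD0 : D ≠ ⊥ := differentIdeal_ne_bot
  have hPm : P ∈ primesAbove p N := mem_primesAbove.mpr ⟨inferInstance, hP⟩
  have hne : ∀ Q ∈ primesAbove p N, Prime Q := by
    intro Q hQ
    rw [mem_primesAbove] at hQ
    obtain ⟨_, _⟩ := hQ
    exact Ideal.prime_of_isPrime
      (Ideal.ne_bot_of_liesOver_of_ne_bot (span_prime_ne_bot (p := p)) Q) ‹_›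
  have hfin : FiniteMultiplicity P D := FiniteMultiplicity.of_not_isUnit (hne P hPm).not_isUnit hD0
  set d := multiplicity P D with hd
  have hdvd : ∀ Q ∈ primesAbove p N, Q ^ d ∣ D := fun Q hQ =>
    dvd_differentIdeal_of_mem_primesAbove P (pow_multiplicity_dvd P D) hQ
  have hnot : ∀ Q ∈ primesAbove p N, ¬ Q ^ (d + 1) ∣ D := by
    intro Q hQ h
    have hQ' := mem_primesAbove.mp hQ
    obtain ⟨_, _⟩ := hQ'
    exact hfin.not_pow_dvd_of_multiplicity_lt (Nat.lt_succ_self _)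
      (dvd_differentIdeal_of_mem_primesAbove Q h hPm)
  obtain ⟨R, hR⟩ := Finset.prod_dvd_of_coprime (pairwise_isCoprime_pow_primesAbove _) hdvd
  have hpR : ¬ p ∣ absNorm R := by
    intro h
    obtain ⟨Q, hQm, hQu, hQR⟩ := exists_isMaximal_dvd_of_dvd_absNorm' hp.out R h
    have hQ : Q ∈ primesAbove p N := mem_primesAbove.mpr ⟨hQm.isPrime, ⟨hQu.symm⟩⟩
    refine hnot Q hQ ?_
    rw [hR, pow_succ]
    exact mul_dvd_mul (Finset.dvd_prod_of_mem (fun Q => Q ^ d) hQ) hQR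
  have hdt : d ≤ Nat.card (P.inertia Gal(N/ℚ)) * t - 1 := by
    by_contra hcon
    apply ht
    apply pow_dvd_finrank_of_differentIdeal_le
    rw [span_natCast_eq_prod_primesAbove P, ← Finset.prod_pow]
    simp_rw [← pow_mul]
    refine Finset.prod_dvd_of_coprime (pairwise_isCoprime_pow_primesAbove _) fun Q hQ => ?_
    exact (pow_dvd_pow Q (Nat.le_of_pred_lt (not_le.mp hcon))).trans (hdvd Q hQ)
  have hR0 : absNorm R ≠ 0 := fun h => hpR (h ▸ dvd_zero _)
  rw [← absNorm_differentIdeal (K := N) (𝒪 := 𝓞 N), ← hD, hR, map_mul, absNorm_prod_primesAbove,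
    padicValNat.mul (pow_ne_zero _ hp.out.ne_zero) hR0, padicValNat.prime_pow,
    padicValNat.eq_zero_of_not_dvd hpR, add_zero, Finset.sum_const, smul_eq_mul]
  gcongr
section Relative

variable (E : IntermediateField ℚ N)

instance isGaloisGroup_fixingSubgroup : IsGaloisGroup E.fixingSubgroup E N :=
  inferInstanceAs (IsGaloisGroup (_root_.fixingSubgroup Gal(N/ℚ) (E : Set N)) E N)

instance isGaloisGroup_fixingSubgroup_ringOfIntegers :
    IsGaloisGroup E.fixingSubgroup (𝓞 E) (𝓞 N) :=
  IsGaloisGroup.of_isFractionRing E.fixingSubgroup (𝓞 E) (𝓞 N) E N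

include hP in
theorem pow_card_inertia_dvd_map_under :
    P ^ Nat.card (P.inertia E.fixingSubgroup) ∣ (P.under (𝓞 E)).map (algebraMap (𝓞 E) (𝓞 N)) ∧
      Nat.card (P.inertia Gal(N/ℚ)) =
        (P.under (𝓞 E)).ramificationIdx ℤ * Nat.card (P.inertia E.fixingSubgroup) := by
  have : P.LiesOver (P.under (𝓞 E)) := ⟨rfl⟩
  have : (P.under (𝓞 E)).LiesOver (span {(p : ℤ)}) :=
    Ideal.LiesOver.tower_bot P (P.under (𝓞 E)) (span {(p : ℤ)})
  have hb : P.under (𝓞 E) ≠ ⊥ :=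
    Ideal.ne_bot_of_liesOver_of_ne_bot (span_prime_ne_bot (p := p)) _
  have : (P.under (𝓞 E)).IsMaximal :=
    Ideal.IsMaximal.of_liesOver_isMaximal _ (span {(p : ℤ)})
  have h1 : Nat.card (P.inertia E.fixingSubgroup) = P.ramificationIdx (𝓞 E) := by
    rw [card_inertia_eq_ramificationIdxIn (P.under (𝓞 E)) P,
      ramificationIdxIn_eq_ramificationIdx (P.under (𝓞 E)) P E.fixingSubgroup]
  rw [h1]
  constructor
  · rw [Ideal.IsDedekindDomain.ramificationIdx_eq_multiplicity (P.under (𝓞 E)) P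
      (map_ne_bot_of_ne_bot hb)]
    exact pow_multiplicity_dvd _ _
  · rw [natCard_inertia_eq_ramificationIdx P (p := p),
      ramificationIdx_tower (P.under (𝓞 E)) P]

include hP in
theorem pow_card_inertia_sub_one_dvd_differentIdeal :
    P ^ (Nat.card (P.inertia E.fixingSubgroup) - 1) ∣ differentIdeal (𝓞 E) (𝓞 N) := by
  have : P.LiesOver (P.under (𝓞 E)) := ⟨rfl⟩
  have : (P.under (𝓞 E)).LiesOver (span {(p : ℤ)}) :=
    Ideal.LiesOver.tower_bot P (P.under (𝓞 E)) (span {(p : ℤ)})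
  have hb : P.under (𝓞 E) ≠ ⊥ :=
    Ideal.ne_bot_of_liesOver_of_ne_bot (span_prime_ne_bot (p := p)) _
  have : (P.under (𝓞 E)).IsMaximal :=
    Ideal.IsMaximal.of_liesOver_isMaximal _ (span {(p : ℤ)})
  exact pow_sub_one_dvd_differentIdeal _ P _ hb (pow_card_inertia_dvd_map_under (p := p) P E).1

include hP in
theorem pow_card_inertia_sub_dvd_map_differentIdeal :
    P ^ (Nat.card (P.inertia Gal(N/ℚ)) - Nat.card (P.inertia E.fixingSubgroup)) ∣
      (differentIdeal ℤ (𝓞 E)).map (algebraMap (𝓞 E) (𝓞 N)) := by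
  set q := P.under (𝓞 E) with hq
  have : P.LiesOver q := ⟨rfl⟩
  have : q.LiesOver (span {(p : ℤ)}) := Ideal.LiesOver.tower_bot P q (span {(p : ℤ)})
  have hpq : (span {(p : ℤ)}).map (algebraMap ℤ (𝓞 E)) ≠ ⊥ :=
    map_ne_bot_of_ne_bot (span_prime_ne_bot (p := p))
  have h1 : q ^ (q.ramificationIdx ℤ - 1) ∣ differentIdeal ℤ (𝓞 E) := by
    refine pow_sub_one_dvd_differentIdeal ℤ (p := span {(p : ℤ)}) q _ span_prime_ne_bot ?_
    rw [Ideal.IsDedekindDomain.ramificationIdx_eq_multiplicity (span {(p : ℤ)}) q hpq]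
    exact pow_multiplicity_dvd _ _
  obtain ⟨h2, h3⟩ := pow_card_inertia_dvd_map_under (p := p) P E
  have h4 := map_dvd (Ideal.mapHom (algebraMap (𝓞 E) (𝓞 N))) h1
  rw [map_pow] at h4
  refine dvd_trans ?_ h4
  refine dvd_trans (dvd_of_eq ?_) (pow_dvd_pow_of_dvd h2 _)
  rw [← pow_mul, h3, Nat.mul_sub_one, mul_comm (Nat.card _)]

theorem le_padicValNat_discr_mul :
    (span {(p : ℤ)}).inertiaDegIn (𝓞 N) * ∑ Q ∈ primesAbove p N,
      (Nat.card (Q.inertia Gal(N/ℚ)) - Nat.card (Q.inertia E.fixingSubgroup)) ≤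
      padicValNat p (discr E).natAbs * Module.finrank E N := by
  have h := prime_pow_sum_dvd_absNorm (p := p)
    (fun Q => Nat.card (Q.inertia Gal(N/ℚ)) - Nat.card (Q.inertia E.fixingSubgroup))
    ((differentIdeal ℤ (𝓞 E)).map (algebraMap (𝓞 E) (𝓞 N))) (fun Q hQ => by
      obtain ⟨_, _⟩ := mem_primesAbove.mp hQ
      exact pow_card_inertia_sub_dvd_map_differentIdeal (p := p) Q E)
  rw [Ideal.absNorm_algebraMap, absNorm_differentIdeal (K := E),
    ← IsFractionRing.finrank_eq (𝓞 E) E (𝓞 N) N] at h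
  have hd : (discr E).natAbs ≠ 0 := Int.natAbs_ne_zero.mpr (discr_ne_zero E)
  rw [padicValNat_dvd_iff_le (pow_ne_zero _ hd), padicValNat.pow] at h
  rwa [mul_comm (padicValNat _ _)]

include hP in
theorem padicValNat_discr_mul_le (ht : ¬ p ∣ Module.finrank ℚ N) :
    padicValNat p (discr E).natAbs * Module.finrank E N ≤
    (span {(p : ℤ)}).inertiaDegIn (𝓞 N) * ∑ Q ∈ primesAbove p N,
      (Nat.card (Q.inertia Gal(N/ℚ)) - Nat.card (Q.inertia E.fixingSubgroup)) := by
  have h := prime_pow_sum_dvd_absNorm (p := p)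
    (fun Q => Nat.card (Q.inertia E.fixingSubgroup) - 1)
    (differentIdeal (𝓞 E) (𝓞 N)) (fun Q hQ => by
      obtain ⟨_, _⟩ := mem_primesAbove.mp hQ
      exact pow_card_inertia_sub_one_dvd_differentIdeal (p := p) Q E)
  have hd : (discr E).natAbs ≠ 0 := Int.natAbs_ne_zero.mpr (discr_ne_zero E)
  have hD0 : absNorm (differentIdeal (𝓞 E) (𝓞 N)) ≠ 0 := by
    rw [Ne, absNorm_eq_zero_iff]
    exact differentIdeal_ne_bot
  rw [padicValNat_dvd_iff_le hD0] at h
  have h2 := padicValNat_discr_le (p := p) P (t := 1) (by simpa using ht)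
  rw [natAbs_discr_eq_absNorm_differentIdeal_mul_natAbs_discr_pow E (𝒪 := 𝓞 E) N (𝓞 N),
    padicValNat.mul hD0 (pow_ne_zero _ hd), padicValNat.pow, mul_one,
    ← smul_eq_mul (primesAbove p N).card, ← Finset.sum_const] at h2
  have h3 : ∑ Q ∈ primesAbove p N, (Nat.card (P.inertia Gal(N/ℚ)) - 1) =
      ∑ Q ∈ primesAbove p N, (Nat.card (Q.inertia E.fixingSubgroup) - 1) +
      ∑ Q ∈ primesAbove p N,
        (Nat.card (Q.inertia Gal(N/ℚ)) - Nat.card (Q.inertia E.fixingSubgroup)) := by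
    rw [← Finset.sum_add_distrib]
    refine Finset.sum_congr rfl fun Q hQ => ?_
    obtain ⟨_, _⟩ := mem_primesAbove.mp hQ
    have h5 := (pow_card_inertia_dvd_map_under (p := p) Q E).2
    have h6 : Nat.card (P.inertia Gal(N/ℚ)) = Nat.card (Q.inertia Gal(N/ℚ)) := by
      rw [natCard_inertia_eq_ramificationIdx P (p := p),
        natCard_inertia_eq_ramificationIdx Q (p := p),
        ramificationIdx_eq_of_isGaloisGroup (span {(p : ℤ)}) P Q Gal(N/ℚ)]
    have h7 : 0 < Nat.card (Q.inertia E.fixingSubgroup) := Nat.card_pos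
    have h8 : 0 < Nat.card (Q.inertia Gal(N/ℚ)) := Nat.card_pos
    have h9 : Nat.card (Q.inertia E.fixingSubgroup) ≤ Nat.card (Q.inertia Gal(N/ℚ)) :=
      Nat.le_of_dvd h8 ⟨_, by rw [h5, mul_comm]⟩
    rw [h6]
    generalize Nat.card (Q.inertia E.fixingSubgroup) = x at *
    generalize Nat.card (Q.inertia Gal(N/ℚ)) = y at *
    omega
  rw [h3, mul_add] at h2
  rw [mul_comm (padicValNat _ _)]
  rw [mul_comm (Module.finrank _ _)] at h2 ⊢
  omega

end Relative

section PermutationAction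

variable {n : ℕ} (E : IntermediateField ℚ N) (ρ : Gal(N/ℚ) →* Equiv.Perm (Fin n)) (y₀ : Fin n)

noncomputable instance fintypeInertiaGalois (I : Ideal (𝓞 N)) : Fintype (I.inertia Gal(N/ℚ)) :=
  Fintype.ofFinite _

omit [IsGalois ℚ N] in
theorem mem_inertia_galois_iff {I : Ideal (𝓞 N)} {σ : Gal(N/ℚ)} :
    σ ∈ I.inertia Gal(N/ℚ) ↔ ∀ x : 𝓞 N, σ • x - x ∈ I := by
  exact AddSubgroup.mem_inertia

omit [IsGalois ℚ N] in
theorem mem_inertia_smul_iff {I : Ideal (𝓞 N)} {σ τ : Gal(N/ℚ)} :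
    τ ∈ (σ • I).inertia Gal(N/ℚ) ↔ σ⁻¹ * τ * σ ∈ I.inertia Gal(N/ℚ) := by
  simp_rw [mem_inertia_galois_iff, mem_pointwise_smul_iff_inv_smul_mem]
  constructor
  · intro h x
    have := h (σ • x)
    rwa [smul_sub, inv_smul_smul, smul_smul, smul_smul] at this
  · intro h x
    have := h (σ⁻¹ • x)
    rwa [smul_smul, mul_assoc, mul_inv_cancel, mul_one, ← smul_smul, ← smul_sub] at this

omit [IsGalois ℚ N] in
theorem card_inertia_smul_sub (hs : ∀ g, ρ g y₀ = y₀ ↔ g ∈ E.fixingSubgroup)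
    (I : Ideal (𝓞 N)) (σ : Gal(N/ℚ)) :
    Nat.card ((σ • I).inertia Gal(N/ℚ)) - Nat.card ((σ • I).inertia E.fixingSubgroup) =
      ∑ h : I.inertia Gal(N/ℚ), if ρ h (ρ σ⁻¹ y₀) ≠ ρ σ⁻¹ y₀ then 1 else 0 := by
  classical
  have h1 : Nat.card ((σ • I).inertia Gal(N/ℚ)) = Fintype.card (I.inertia Gal(N/ℚ)) := by
    rw [← Nat.card_eq_fintype_card]
    refine Nat.card_congr ⟨fun τ => ⟨σ⁻¹ * τ * σ, mem_inertia_smul_iff.mp τ.2⟩,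
      fun τ => ⟨σ * τ * σ⁻¹, mem_inertia_smul_iff.mpr (by
        have : σ⁻¹ * (σ * τ * σ⁻¹) * σ = (τ : Gal(N/ℚ)) := by group
        rw [this]; exact τ.2)⟩, fun τ => Subtype.ext (by simp [mul_assoc]),
        fun τ => Subtype.ext (by simp [mul_assoc])⟩
  have key : ∀ τ : Gal(N/ℚ), ρ τ (ρ σ⁻¹ y₀) = ρ σ⁻¹ y₀ ↔ σ * τ * σ⁻¹ ∈ E.fixingSubgroup := by
    intro τ
    rw [← hs, map_mul, map_mul, Equiv.Perm.mul_apply, Equiv.Perm.mul_apply, map_inv,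
      Equiv.Perm.eq_inv_iff_eq]
  have h2 : Nat.card ((σ • I).inertia E.fixingSubgroup) =
      (Finset.univ.filter fun h : I.inertia Gal(N/ℚ) => ρ h (ρ σ⁻¹ y₀) = ρ σ⁻¹ y₀).card := by
    rw [← Fintype.card_subtype, ← Nat.card_eq_fintype_card]
    refine Nat.card_congr ⟨fun τ => ⟨⟨σ⁻¹ * (τ : E.fixingSubgroup) * σ,
      mem_inertia_smul_iff.mp (show ((τ : E.fixingSubgroup) : Gal(N/ℚ)) ∈ _ from τ.2)⟩, ?_⟩,
      fun τ => ⟨⟨σ * (τ.1 : Gal(N/ℚ)) * σ⁻¹, (key _).mp τ.2⟩, ?_⟩, ?_, ?_⟩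
    · rw [key]
      have : σ * (σ⁻¹ * ((τ : E.fixingSubgroup) : Gal(N/ℚ)) * σ) * σ⁻¹ =
        ((τ : E.fixingSubgroup) : Gal(N/ℚ)) := by group
      simp only [this]
      exact τ.1.2
    · show (σ * (τ.1 : Gal(N/ℚ)) * σ⁻¹) ∈ (σ • I).inertia Gal(N/ℚ)
      rw [mem_inertia_smul_iff]
      have : σ⁻¹ * (σ * τ.1 * σ⁻¹) * σ = (τ.1 : Gal(N/ℚ)) := by group
      rw [this]; exact τ.1.2
    · intro τ
      ext1; ext1
      simp [mul_assoc]
    · intro τ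
      ext1; ext1
      simp [mul_assoc]
  rw [h1, h2, ← Finset.card_filter, ← Finset.card_univ,
    ← Finset.card_filter_add_card_filter_not (s := Finset.univ)
      (p := fun h : I.inertia Gal(N/ℚ) => ρ h (ρ σ⁻¹ y₀) = ρ σ⁻¹ y₀), Nat.add_sub_cancel_left]

theorem sum_galois_inv_apply (hρ : ∀ y, ∃ g, ρ g y₀ = y)
    (hs : ∀ g, ρ g y₀ = y₀ ↔ g ∈ E.fixingSubgroup) (F : Fin n → ℕ) :
    ∑ σ : Gal(N/ℚ), F (ρ σ⁻¹ y₀) = Module.finrank E N * ∑ y, F y := by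
  classical
  rw [← Finset.sum_fiberwise (g := fun σ : Gal(N/ℚ) => ρ σ⁻¹ y₀), Finset.mul_sum]
  refine Finset.sum_congr rfl fun y _ => ?_
  rw [Finset.sum_congr rfl (g := fun _ => F y), Finset.sum_const, smul_eq_mul]
  · congr 1
    rw [← IsGaloisGroup.card_eq_finrank E.fixingSubgroup E N, ← Fintype.card_subtype,
      ← Nat.card_eq_fintype_card]
    obtain ⟨g, rfl⟩ := hρ y
    refine Nat.card_congr ⟨fun τ => ⟨g⁻¹ * τ.1⁻¹, ?_⟩, fun τ => ⟨τ.1⁻¹ * g⁻¹, ?_⟩, ?_, ?_⟩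
    · rw [← hs, map_mul, Equiv.Perm.mul_apply, τ.2, map_inv]
      simp
    · rw [mul_inv_rev, inv_inv, inv_inv, map_mul, Equiv.Perm.mul_apply, (hs _).mpr τ.2]
    · intro τ; ext1; simp
    · intro τ; ext1; simp
  · intro σ hσ
    rw [(Finset.mem_filter.mp hσ).2]

include hP in
theorem card_inertia_mul_sum_primesAbove (hρ : ∀ y, ∃ g, ρ g y₀ = y)
    (hs : ∀ g, ρ g y₀ = y₀ ↔ g ∈ E.fixingSubgroup) :
    Nat.card (P.inertia Gal(N/ℚ)) * ((span {(p : ℤ)}).inertiaDegIn (𝓞 N) *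
      ∑ Q ∈ primesAbove p N,
        (Nat.card (Q.inertia Gal(N/ℚ)) - Nat.card (Q.inertia E.fixingSubgroup))) =
    Module.finrank E N * ∑ h : P.inertia Gal(N/ℚ), (ρ h).support.card := by
  rw [← mul_assoc, ← natCard_stabilizer_eq_inertia_mul P (p := p), ← smul_eq_mul,
    ← sum_galois_smul P (p := p)
      fun Q => Nat.card (Q.inertia Gal(N/ℚ)) - Nat.card (Q.inertia E.fixingSubgroup)]
  simp_rw [card_inertia_smul_sub E ρ y₀ hs]
  rw [sum_galois_inv_apply E ρ y₀ hρ hs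
    fun y => ∑ h : P.inertia Gal(N/ℚ), if ρ h y ≠ y then 1 else 0, Finset.sum_comm]
  congr 1
  refine Finset.sum_congr rfl fun h _ => ?_
  rw [← Finset.card_filter]
  rfl

include hP in
/-- The `p`-adic valuation of the discriminant of a subfield of a Galois field is bounded below
by the average number of points moved by inertia. -/
theorem sum_support_le_card_inertia_mul_padicValNat (hρ : ∀ y, ∃ g, ρ g y₀ = y)
    (hs : ∀ g, ρ g y₀ = y₀ ↔ g ∈ E.fixingSubgroup) :
    ∑ h : P.inertia Gal(N/ℚ), (ρ h).support.card ≤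
      Nat.card (P.inertia Gal(N/ℚ)) * padicValNat p (discr E).natAbs := by
  have h1 := card_inertia_mul_sum_primesAbove (p := p) P E ρ y₀ hρ hs
  have h2 := Nat.mul_le_mul_left (Nat.card (P.inertia Gal(N/ℚ)))
    (le_padicValNat_discr_mul (p := p) E)
  rw [h1, ← mul_assoc, mul_comm] at h2
  exact Nat.le_of_mul_le_mul_right h2 Module.finrank_pos

include hP in
/-- For tame primes, the `p`-adic valuation of the discriminant of a subfield of a Galois field
is the average number of points moved by inertia. -/
theorem sum_support_eq_card_inertia_mul_padicValNat (hρ : ∀ y, ∃ g, ρ g y₀ = y)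
    (hs : ∀ g, ρ g y₀ = y₀ ↔ g ∈ E.fixingSubgroup) (ht : ¬ p ∣ Module.finrank ℚ N) :
    Nat.card (P.inertia Gal(N/ℚ)) * padicValNat p (discr E).natAbs =
      ∑ h : P.inertia Gal(N/ℚ), (ρ h).support.card := by
  refine le_antisymm ?_ (sum_support_le_card_inertia_mul_padicValNat (p := p) P E ρ y₀ hρ hs)
  have h1 := card_inertia_mul_sum_primesAbove (p := p) P E ρ y₀ hρ hs
  have h2 := Nat.mul_le_mul_left (Nat.card (P.inertia Gal(N/ℚ)))
    (padicValNat_discr_mul_le (p := p) P E ht)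
  rw [h1, ← mul_assoc, mul_comm (Module.finrank E N)] at h2
  exact Nat.le_of_mul_le_mul_right h2 Module.finrank_pos

end PermutationAction

include hP in
/-- A bound for the power of `p` in the discriminant of a subfield, valid for wild primes too. -/
theorem padicValNat_discr_mul_finrank_le (E : IntermediateField ℚ N) {t : ℕ}
    (ht : ¬ p ^ t ∣ Module.finrank ℚ N) :
    Module.finrank E N * padicValNat p (discr E).natAbs ≤ Module.finrank ℚ N * t := by
  have hd : (discr E).natAbs ≠ 0 := Int.natAbs_ne_zero.mpr (discr_ne_zero E)
  have hD0 : absNorm (differentIdeal (𝓞 E) (𝓞 N)) ≠ 0 := by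
    rw [Ne, absNorm_eq_zero_iff]
    exact differentIdeal_ne_bot
  have h := padicValNat_discr_le (p := p) P ht
  rw [natAbs_discr_eq_absNorm_differentIdeal_mul_natAbs_discr_pow E (𝒪 := 𝓞 E) N (𝓞 N),
    padicValNat.mul hD0 (pow_ne_zero _ hd), padicValNat.pow] at h
  have h1 := sum_galois_smul (p := p) P (fun _ => 1)
  rw [Finset.sum_const, Finset.sum_const, smul_eq_mul, mul_one, smul_eq_mul, smul_eq_mul, mul_one,
    Finset.card_univ, ← Nat.card_eq_fintype_card, IsGaloisGroup.card_eq_finrank Gal(N/ℚ) ℚ N,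
    natCard_stabilizer_eq_inertia_mul P (p := p)] at h1
  calc Module.finrank E N * padicValNat p (discr E).natAbs
      ≤ _ := (Nat.le_add_left _ _).trans h
    _ ≤ (span {(p : ℤ)}).inertiaDegIn (𝓞 N) *
          ((primesAbove p N).card * (Nat.card (P.inertia Gal(N/ℚ)) * t)) := by
        gcongr; exact Nat.sub_le _ _
    _ = _ := by rw [h1]; ring

end LocalTheory

section TameInertia

open NumberField Ideal Pointwise

variable {N : Type*} [Field N] [NumberField N] [IsGalois ℚ N] {p : ℕ} [hp : Fact p.Prime]
  (P : Ideal (𝓞 N)) [P.IsPrime] [hP : P.LiesOver (span {(p : ℤ)})]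
  {n m : ℕ} (E : IntermediateField ℚ N) (ρ : Gal(N/ℚ) →* Equiv.Perm (Fin n)) (y₀ : Fin n)
  (E' : IntermediateField ℚ N) (ρ' : Gal(N/ℚ) →* Equiv.Perm (Fin m)) (x₀ : Fin m)

include hP in
theorem padicValNat_discr_lt (hρ : ∀ y, ∃ g, ρ g y₀ = y)
    (hs : ∀ g, ρ g y₀ = y₀ ↔ g ∈ E.fixingSubgroup) (ht : ¬ p ∣ Module.finrank ℚ N) :
    padicValNat p (discr E).natAbs < n := by
  have h1 := sum_support_eq_card_inertia_mul_padicValNat P E ρ y₀ hρ hs ht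
  have h2 : ∑ h : P.inertia Gal(N/ℚ), (ρ h).support.card <
      ∑ _h : P.inertia Gal(N/ℚ), n := by
    refine Finset.sum_lt_sum (fun h _ => ?_) ⟨1, Finset.mem_univ _, ?_⟩
    · simpa using (ρ h).support.card_le_univ
    · simpa using y₀.pos
  rw [← h1, Finset.sum_const, Finset.card_univ, ← Nat.card_eq_fintype_card, smul_eq_mul] at h2
  exact lt_of_mul_lt_mul_left h2 (Nat.zero_le _)

include hP in
theorem padicValNat_discr_le_padicValNat_discr (hρ : ∀ y, ∃ g, ρ g y₀ = y)
    (hs : ∀ g, ρ g y₀ = y₀ ↔ g ∈ E.fixingSubgroup)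
    (hρ' : ∀ y, ∃ g, ρ' g x₀ = y) (hs' : ∀ g, ρ' g x₀ = x₀ ↔ g ∈ E'.fixingSubgroup)
    (ht : ¬ p ∣ Module.finrank ℚ N) (hle : ∀ g, (ρ g).support.card ≤ (ρ' g).support.card) :
    padicValNat p (discr E).natAbs ≤ padicValNat p (discr E').natAbs := by
  have h1 := sum_support_eq_card_inertia_mul_padicValNat P E ρ y₀ hρ hs ht
  have h2 := sum_support_eq_card_inertia_mul_padicValNat P E' ρ' x₀ hρ' hs' ht
  refine le_of_mul_le_mul_left (a := Nat.card (P.inertia Gal(N/ℚ))) ?_ Nat.card_pos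
  rw [h1, h2]
  exact Finset.sum_le_sum fun h _ => hle h

omit [IsGalois ℚ N] in
theorem two_le_card_support (hinj : Function.Injective ρ) {g : Gal(N/ℚ)} (hg : g ≠ 1) :
    2 ≤ (ρ g).support.card := by
  have h0 : (ρ g).support.card ≠ 0 := by
    rw [Ne, Finset.card_eq_zero, Equiv.Perm.support_eq_empty_iff]
    exact fun h => hg (hinj (h.trans (map_one ρ).symm))
  have h1 := Equiv.Perm.card_support_ne_one (ρ g)
  omega

omit [P.IsPrime] [IsGalois ℚ N] in
theorem two_mul_card_inertia_sub_one_le (hinj : Function.Injective ρ) :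
    2 * (Nat.card (P.inertia Gal(N/ℚ)) - 1) ≤
      ∑ h : P.inertia Gal(N/ℚ), (ρ h).support.card := by
  classical
  have h1 : ∑ _h ∈ Finset.univ.erase (1 : P.inertia Gal(N/ℚ)), 2 ≤
      ∑ h ∈ Finset.univ.erase (1 : P.inertia Gal(N/ℚ)), (ρ h).support.card := by
    refine Finset.sum_le_sum fun h hh => two_le_card_support ρ hinj fun h' => ?_
    exact (Finset.mem_erase.mp hh).1 (Subtype.ext h')
  rw [Finset.sum_const, Finset.card_erase_of_mem (Finset.mem_univ _), Finset.card_univ,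
    ← Nat.card_eq_fintype_card, smul_eq_mul, mul_comm] at h1
  exact h1.trans (Finset.sum_le_sum_of_subset (Finset.erase_subset _ _))

include hP in
theorem padicValNat_discr_eq_three (hρ : ∀ y, ∃ g, ρ g y₀ = y)
    (hs : ∀ g, ρ g y₀ = y₀ ↔ g ∈ E.fixingSubgroup) (hinj : Function.Injective ρ)
    (hρ' : ∀ y, ∃ g, ρ' g x₀ = y) (hs' : ∀ g, ρ' g x₀ = x₀ ↔ g ∈ E'.fixingSubgroup)
    (ht : ¬ p ∣ Module.finrank ℚ N)
    (h26 : ∀ g, (ρ g).support.card = 2 → (ρ' g).support.card = 6)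
    (hone : padicValNat p (discr E).natAbs = 1) :
    padicValNat p (discr E').natAbs = 3 := by
  have h1 := sum_support_eq_card_inertia_mul_padicValNat P E ρ y₀ hρ hs ht
  have h2 := sum_support_eq_card_inertia_mul_padicValNat P E' ρ' x₀ hρ' hs' ht
  have h3 := two_mul_card_inertia_sub_one_le P ρ hinj
  rw [hone, mul_one] at h1
  have h4 : Nat.card (P.inertia Gal(N/ℚ)) ≤ 2 := by omega
  refine Nat.eq_of_mul_eq_mul_left (Nat.card_pos (α := P.inertia Gal(N/ℚ))) ?_
  rw [h2]
  conv_rhs => rw [h1]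
  rw [Finset.sum_mul]
  refine Finset.sum_congr rfl fun h _ => ?_
  by_cases hh : (h : Gal(N/ℚ)) = 1
  · simp [hh]
  · have h5 := two_le_card_support ρ hinj hh
    have h6 : (ρ h).support.card ≤ ∑ h : P.inertia Gal(N/ℚ), (ρ h).support.card :=
      Finset.single_le_sum (f := fun h : P.inertia Gal(N/ℚ) => (ρ h).support.card)
        (fun _ _ => Nat.zero_le _) (Finset.mem_univ h)
    have h7 : (ρ h).support.card = 2 := by omega
    rw [h7, h26 h h7]
    norm_num

include hP in
theorem exists_three_le_card_support (hρ : ∀ y, ∃ g, ρ g y₀ = y)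
    (hs : ∀ g, ρ g y₀ = y₀ ↔ g ∈ E.fixingSubgroup)
    (htwo : 2 ≤ padicValNat p (discr E).natAbs) (ht : ¬ p ∣ Module.finrank ℚ N) :
    ∃ h ∈ P.inertia Gal(N/ℚ), 3 ≤ (ρ h).support.card := by
  by_contra! hc
  have h1 := sum_support_eq_card_inertia_mul_padicValNat P E ρ y₀ hρ hs ht
  have h2 : ∑ h : P.inertia Gal(N/ℚ), (ρ h).support.card <
      ∑ _h : P.inertia Gal(N/ℚ), 2 :=
    Finset.sum_lt_sum (fun h _ => Nat.lt_succ_iff.mp (hc h h.2))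
      ⟨1, Finset.mem_univ _, by simp⟩
  rw [← h1, Finset.sum_const, Finset.card_univ, ← Nat.card_eq_fintype_card, smul_eq_mul] at h2
  exact absurd (lt_of_mul_lt_mul_left h2 (Nat.zero_le _)) (not_lt.mpr htwo)

include hP in
theorem exists_inertia_apply_eq (hρ : ∀ y, ∃ g, ρ g y₀ = y)
    (hs : ∀ g, ρ g y₀ = y₀ ↔ g ∈ E.fixingSubgroup)
    (hk : padicValNat p (discr E).natAbs + 1 = n) (ht : ¬ p ∣ Module.finrank ℚ N) (y : Fin n) :
    ∃ h ∈ P.inertia Gal(N/ℚ), ρ h y₀ = y := by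
  classical
  have h1 := sum_support_eq_card_inertia_mul_padicValNat P E ρ y₀ hρ hs ht
  let _ : MulAction (P.inertia Gal(N/ℚ)) (Fin n) :=
    MulAction.compHom (Fin n) (ρ.comp (P.inertia Gal(N/ℚ)).subtype)
  have hsmul : ∀ (h : P.inertia Gal(N/ℚ)) (y : Fin n), h • y = ρ h y := fun _ _ => rfl
  have h2 := MulAction.sum_card_fixedBy_eq_card_orbits_mul_card_group (P.inertia Gal(N/ℚ)) (Fin n)
  have h3 : ∀ h : P.inertia Gal(N/ℚ),
      Fintype.card (MulAction.fixedBy (Fin n) h) + (ρ h).support.card = n := by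
    intro h
    have : Fintype.card (MulAction.fixedBy (Fin n) h) = (ρ h).supportᶜ.card := by
      rw [← Fintype.card_coe]
      exact Fintype.card_congr (Equiv.subtypeEquivRight fun x => by
        simp [MulAction.mem_fixedBy, hsmul])
    rw [this, add_comm, Finset.card_add_card_compl, Fintype.card_fin]
  have h4 : ∑ h : P.inertia Gal(N/ℚ), Fintype.card (MulAction.fixedBy (Fin n) h) +
      ∑ h : P.inertia Gal(N/ℚ), (ρ h).support.card = Nat.card (P.inertia Gal(N/ℚ)) * n := by
    rw [← Finset.sum_add_distrib, Finset.sum_congr rfl fun h _ => h3 h, Finset.sum_const,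
      Finset.card_univ, smul_eq_mul, Nat.card_eq_fintype_card]
  rw [h2, ← h1, ← Nat.card_eq_fintype_card (α := P.inertia Gal(N/ℚ)), mul_comm, ← mul_add] at h4
  have h5 := Nat.eq_of_mul_eq_mul_left Nat.card_pos h4
  have h6 : Fintype.card (MulAction.orbitRel.Quotient (P.inertia Gal(N/ℚ)) (Fin n)) = 1 := by
    have : Fintype.card (MulAction.orbitRel.Quotient (P.inertia Gal(N/ℚ)) (Fin n)) +
      padicValNat p (discr E).natAbs = n := h5
    omega
  have h7 := Fintype.card_le_one_iff.mp h6.le (Quotient.mk'' y) (Quotient.mk'' y₀)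
  obtain ⟨h, hh⟩ := MulAction.orbitRel_apply.mp (Quotient.eq''.mp h7)
  exact ⟨h, h.2, hh⟩

end TameInertia

section QuinticShapes

open Polynomial

/-- The depressed monic quintic polynomial with the given coefficients. -/
noncomputable def quintic {R : Type*} [CommRing R] (a b c d : R) : R[X] :=
  X ^ 5 + C a * X ^ 3 + C b * X ^ 2 + C c * X + C d

theorem map_quintic {R S : Type*} [CommRing R] [CommRing S] (f : R →+* S) (a b c d : R) :
    (quintic a b c d).map f = quintic (f a) (f b) (f c) (f d) := by
  simp [quintic]

theorem coeff_of_quintic_eq_prod {R : Type*} [CommRing R] {a b c d x y z u v : R}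
    (h : (X - C x) * (X - C y) * (X - C z) * (X - C u) * (X - C v) = quintic a b c d) :
    v = -(x + y + z + u) ∧
    a = x * y + x * z + x * u + x * v + y * z + y * u + y * v + z * u + z * v + u * v ∧
    b = -(x * y * z + x * y * u + x * y * v + x * z * u + x * z * v + x * u * v +
      y * z * u + y * z * v + y * u * v + z * u * v) ∧
    c = x * y * z * u + x * y * z * v + x * y * u * v + x * z * u * v + y * z * u * v ∧
    d = -(x * y * z * u * v) := by
  have key : (X - C x) * (X - C y) * (X - C z) * (X - C u) * (X - C v) =
      X ^ 5 + C (-(x + y + z + u + v)) * X ^ 4 +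
      C (x * y + x * z + x * u + x * v + y * z + y * u + y * v + z * u + z * v + u * v) * X ^ 3 +
      C (-(x * y * z + x * y * u + x * y * v + x * z * u + x * z * v + x * u * v +
      y * z * u + y * z * v + y * u * v + z * u * v)) * X ^ 2 +
      C (x * y * z * u + x * y * z * v + x * y * u * v + x * z * u * v + y * z * u * v) * X +
      C (-(x * y * z * u * v)) := by
    simp only [map_neg, map_add, map_mul]; ring
  rw [key, quintic] at h
  have h4 := congrArg (coeff · 4) h
  have h3 := congrArg (coeff · 3) h
  have h2 := congrArg (coeff · 2) h
  have h1 := congrArg (coeff · 1) h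
  have h0 := congrArg (coeff · 0) h
  simp only [coeff_add, coeff_X_pow, coeff_C_mul, coeff_C, coeff_X] at h0 h1 h2 h3 h4
  norm_num at h0 h1 h2 h3 h4
  refine ⟨by linear_combination -h4, ?_, ?_, ?_, ?_⟩
  · linear_combination -h3
  · linear_combination -h2
  · linear_combination -h1
  · linear_combination -h0

/-- The possible values of the last two coefficients of a depressed quintic polynomial with
two double roots or a triple root, in terms of the first two coefficients. -/
def doubleRootsSet (p : ℕ) [Fact p.Prime] (a b : ZMod p) : Set (ZMod p × ZMod p) :=
  {x | ∃ s : AlgebraicClosure (ZMod p),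
    (5 * s ^ 3 + algebraMap _ _ a * s - algebraMap _ _ b = 0 ∧
      4 * algebraMap _ _ x.1 = (algebraMap _ _ a + 3 * s ^ 2) ^ 2 -
        8 * s ^ 2 * (algebraMap _ _ a + 3 * s ^ 2) ∧
      2 * algebraMap _ _ x.2 = s * (algebraMap _ _ a + 3 * s ^ 2) ^ 2) ∨
    (10 * s ^ 3 + 3 * algebraMap _ _ a * s + algebraMap _ _ b = 0 ∧
      algebraMap _ _ x.1 = 3 * algebraMap _ _ a * s ^ 2 + 15 * s ^ 4 ∧
      algebraMap _ _ x.2 = - s ^ 3 * (algebraMap _ _ a + 6 * s ^ 2))}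

theorem natCast_ne_zero_of_lt {p : ℕ} {F : Type*} [Field F] [CharP F p] {n : ℕ}
    (hn : 0 < n) (hnp : n < p) : (n : F) ≠ 0 := by
  rw [Ne, CharP.cast_eq_zero_iff F p]
  exact fun h => absurd (Nat.le_of_dvd hn h) (not_le.mpr hnp)

theorem exists_finset_cubic_roots {F : Type*} [Field F] {a b c : F} (ha : a ≠ 0) :
    ∃ T : Finset F, T.card ≤ 3 ∧ ∀ s, a * s ^ 3 + b * s + c = 0 → s ∈ T := by
  classical
  set q : F[X] := C a * X ^ 3 + C 0 * X ^ 2 + C b * X + C c with hq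
  have hq0 : q ≠ 0 := by
    intro h
    apply ha
    have := congrArg (coeff · 3) h
    simpa [hq, coeff_X, coeff_C] using this
  refine ⟨q.roots.toFinset, ?_, fun s hs => ?_⟩
  · exact (Multiset.toFinset_card_le _).trans ((card_roots' q).trans natDegree_cubic_le)
  · rw [Multiset.mem_toFinset, mem_roots hq0, IsRoot, hq]
    simpa using hs

theorem ncard_doubleRootsSet_le {p : ℕ} [Fact p.Prime] (hp : 5 < p) (a b : ZMod p) :
    (doubleRootsSet p a b).ncard ≤ 6 := by
  classical
  have hchar : CharP (AlgebraicClosure (ZMod p)) p := charP_of_injective_algebraMap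
    (algebraMap (ZMod p) (AlgebraicClosure (ZMod p))).injective p
  have h5 : (5 : AlgebraicClosure (ZMod p)) ≠ 0 := by
    exact_mod_cast natCast_ne_zero_of_lt (p := p) (n := 5) (by norm_num) hp
  have h2 : (2 : AlgebraicClosure (ZMod p)) ≠ 0 := by
    exact_mod_cast natCast_ne_zero_of_lt (p := p) (n := 2) (by norm_num) (by omega)
  have h4 : (4 : AlgebraicClosure (ZMod p)) ≠ 0 := by
    exact_mod_cast natCast_ne_zero_of_lt (p := p) (n := 4) (by norm_num) (by omega)
  have h10 : (10 : AlgebraicClosure (ZMod p)) ≠ 0 := by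
    rw [show (10 : AlgebraicClosure (ZMod p)) = 2 * 5 by norm_num]
    exact mul_ne_zero h2 h5
  obtain ⟨T₁, hT₁, hm₁⟩ := exists_finset_cubic_roots (b := algebraMap _ _ a)
    (c := - algebraMap (ZMod p) (AlgebraicClosure (ZMod p)) b) h5
  obtain ⟨T₂, hT₂, hm₂⟩ := exists_finset_cubic_roots (b := 3 * algebraMap _ _ a)
    (c := algebraMap (ZMod p) (AlgebraicClosure (ZMod p)) b) h10
  let ι : ZMod p × ZMod p → AlgebraicClosure (ZMod p) × AlgebraicClosure (ZMod p) :=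
    Prod.map (algebraMap _ _) (algebraMap _ _)
  have hι : Function.Injective ι := Function.Injective.prodMap
    (algebraMap (ZMod p) (AlgebraicClosure (ZMod p))).injective
    (algebraMap (ZMod p) (AlgebraicClosure (ZMod p))).injective
  let F₁ : AlgebraicClosure (ZMod p) → AlgebraicClosure (ZMod p) × AlgebraicClosure (ZMod p) :=
    fun s => (((algebraMap _ _ a + 3 * s ^ 2) ^ 2 - 8 * s ^ 2 * (algebraMap _ _ a + 3 * s ^ 2)) / 4,
      s * (algebraMap _ _ a + 3 * s ^ 2) ^ 2 / 2)
  let F₂ : AlgebraicClosure (ZMod p) → AlgebraicClosure (ZMod p) × AlgebraicClosure (ZMod p) :=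
    fun s => (3 * algebraMap _ _ a * s ^ 2 + 15 * s ^ 4, - s ^ 3 * (algebraMap _ _ a + 6 * s ^ 2))
  rw [← Set.ncard_image_of_injective _ hι]
  have hsub : ι '' doubleRootsSet p a b ⊆ ((T₁.image F₁ ∪ T₂.image F₂ : Finset _) : Set _) := by
    rintro _ ⟨x, ⟨s, ⟨h1, h2', h3⟩ | ⟨h1, h2', h3⟩⟩, rfl⟩
    · rw [Finset.coe_union]
      refine Or.inl (Finset.mem_coe.mpr (Finset.mem_image.mpr ⟨s, hm₁ s ?_, ?_⟩))
      · rw [← h1]; ring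
      · refine Prod.ext ?_ ?_
        · exact (div_eq_iff h4).mpr (by rw [← h2', mul_comm]; rfl)
        · exact (div_eq_iff h2).mpr (by rw [← h3, mul_comm]; rfl)
    · rw [Finset.coe_union]
      refine Or.inr (Finset.mem_coe.mpr (Finset.mem_image.mpr ⟨s, hm₂ s h1, ?_⟩))
      exact Prod.ext h2'.symm h3.symm
  refine (Set.ncard_le_ncard hsub (Finset.finite_toSet _)).trans ?_
  rw [Set.ncard_coe_finset]
  have h1 := Finset.card_union_le (T₁.image F₁) (T₂.image F₂)
  have h2 := Finset.card_image_le (s := T₁) (f := F₁)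
  have h3 := Finset.card_image_le (s := T₂) (f := F₂)
  omega

theorem exists_perm_coincidences {α : Type*} (σ : Equiv.Perm (Fin 5)) (hσ : 3 ≤ σ.support.card)
    (β : Fin 5 → α) (hβ : ∀ y, β (σ y) = β y) :
    ∃ e : Equiv.Perm (Fin 5), (β (e 1) = β (e 0) ∧ β (e 2) = β (e 0)) ∨
      (β (e 1) = β (e 0) ∧ β (e 3) = β (e 2)) := by
  obtain ⟨y, hy⟩ : ∃ y, y ∈ σ.support := Finset.card_pos.mp (by omega)
  rw [Equiv.Perm.mem_support] at hy
  by_cases hyy : σ (σ y) = y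
  · obtain ⟨z, hz, hz'⟩ := Finset.exists_mem_notMem_of_card_lt_card
      (s := {y, σ y}) (t := σ.support) (Finset.card_le_two.trans_lt hσ)
    rw [Equiv.Perm.mem_support] at hz
    simp only [Finset.mem_insert, Finset.mem_singleton, not_or] at hz'
    have h1 : σ z ≠ y := fun h => hz'.2 (σ.injective (h.trans hyy.symm))
    have h2 : σ z ≠ σ y := fun h => hz'.1 (σ.injective h)
    let f : Fin 4 ↪ Fin 5 := ⟨![y, σ y, z, σ z], by
      have h12 := hz'.1
      have h13 := hz'.2
      intro i j hij
      fin_cases i <;> fin_cases j <;> first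
        | rfl
        | exact absurd hij hy
        | exact absurd hij hz
        | exact absurd hij h1
        | exact absurd hij h2
        | exact absurd hij h12
        | exact absurd hij h13
        | exact absurd hij hy.symm
        | exact absurd hij hz.symm
        | exact absurd hij h1.symm
        | exact absurd hij h2.symm
        | exact absurd hij (Ne.symm h12)
        | exact absurd hij (Ne.symm h13)⟩
    have := Equiv.Perm.isMultiplyPretransitive (Fin 5) 4
    obtain ⟨e, he⟩ := MulAction.exists_smul_eq (M := Equiv.Perm (Fin 5))
      (Fin.castLEEmb (by norm_num : 4 ≤ 5)) f
    refine ⟨e, Or.inr ?_⟩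
    have h0 := DFunLike.congr_fun he 0
    have h1 := DFunLike.congr_fun he 1
    have h2 := DFunLike.congr_fun he 2
    have h3 := DFunLike.congr_fun he 3
    change e 0 = y at h0
    change e 1 = σ y at h1
    change e 2 = z at h2
    change e 3 = σ z at h3
    rw [h0, h1, h2, h3]
    exact ⟨hβ y, hβ z⟩
  · have h1 : σ (σ y) ≠ σ y := fun h => hy (σ.injective h)
    let f : Fin 3 ↪ Fin 5 := ⟨![y, σ y, σ (σ y)], by
      intro i j hij
      fin_cases i <;> fin_cases j <;> first
        | rfl
        | exact absurd hij hy
        | exact absurd hij h1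
        | exact absurd hij hyy
        | exact absurd hij hy.symm
        | exact absurd hij h1.symm
        | exact absurd hij (Ne.symm hyy)⟩
    have := Equiv.Perm.isMultiplyPretransitive (Fin 5) 3
    obtain ⟨e, he⟩ := MulAction.exists_smul_eq (M := Equiv.Perm (Fin 5))
      (Fin.castLEEmb (by norm_num : 3 ≤ 5)) f
    refine ⟨e, Or.inl ?_⟩
    have h0 := DFunLike.congr_fun he 0
    have h1 := DFunLike.congr_fun he 1
    have h2 := DFunLike.congr_fun he 2
    change e 0 = y at h0
    change e 1 = σ y at h1
    change e 2 = σ (σ y) at h2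
    rw [h0, h1, h2]
    exact ⟨hβ y, by rw [hβ, hβ]⟩

theorem mem_doubleRootsSet {p : ℕ} [Fact p.Prime] (σ : Equiv.Perm (Fin 5))
    (hσ : 3 ≤ σ.support.card) (β : Fin 5 → AlgebraicClosure (ZMod p)) (hβ : ∀ y, β (σ y) = β y)
    {a b c d : ZMod p} (h : ∏ y, (X - C (β y)) = (quintic a b c d).map (algebraMap _ _)) :
    (c, d) ∈ doubleRootsSet p a b := by
  obtain ⟨e, he⟩ := exists_perm_coincidences σ hσ β hβ
  rw [map_quintic, ← Equiv.prod_comp e, Fin.prod_univ_five] at h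
  obtain ⟨h4, h3, h2, h1, h0⟩ := coeff_of_quintic_eq_prod h
  rcases he with ⟨h01, h02⟩ | ⟨h01, h23⟩
  · refine ⟨β (e 0), Or.inr ⟨?_, ?_, ?_⟩⟩
    · rw [h2, h3, h4, h01, h02]; ring
    · change algebraMap _ _ c = _
      rw [h1, h3, h4, h01, h02]; ring
    · change algebraMap _ _ d = _
      rw [h0, h3, h4, h01, h02]; ring
  · refine ⟨β (e 0) + β (e 2), Or.inl ⟨?_, ?_, ?_⟩⟩
    · rw [h2, h3, h4, h01, h23]; ring
    · change 4 * algebraMap _ _ c = _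
      rw [h1, h3, h4, h01, h23]; ring
    · change 2 * algebraMap _ _ d = _
      rw [h0, h3, h4, h01, h23]; ring

end QuinticShapes

section Minkowski

open NumberField NumberField.InfinitePlace NumberField.mixedEmbedding MeasureTheory Module
open scoped NNReal ENNReal

theorem minkowskiBound_one_le (L : Type*) [Field L] [NumberField L] :
    minkowskiBound L ↑1 ≤ ((NNReal.sqrt ‖discr L‖₊ * 2 ^ finrank ℚ L : ℝ≥0) : ℝ≥0∞) := by
  rw [minkowskiBound, volume_fundamentalDomain_fractionalIdealLatticeBasis,
    Units.val_one, FractionalIdeal.absNorm_one, Rat.cast_one,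
    ENNReal.ofReal_one, one_mul, mixedEmbedding.finrank, volume_fundamentalDomain_latticeBasis,
    ENNReal.coe_mul, ENNReal.coe_pow, ENNReal.coe_ofNat,
    show (NNReal.sqrt ‖discr L‖₊ : ℝ≥0∞) = 1 * NNReal.sqrt ‖discr L‖₊ by rw [one_mul]]
  gcongr
  · exact pow_le_one₀ (by positivity) (by simp)
  · exact (one_mul _).le

/-- A number field of odd degree has a small integral element
that is not a rational integer. -/
theorem exists_ringOfIntegers_ne_intCast_forall_lt (L : Type*) [Field L] [NumberField L]
    (hodd : Odd (finrank ℚ L)) {T : ℝ≥0} (hT : 1 ≤ T)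
    (h : NNReal.sqrt ‖discr L‖₊ * 2 ^ (finrank ℚ L + 1) < T ^ (finrank ℚ L - 1)) :
    ∃ α : 𝓞 L, (∀ n : ℤ, α ≠ n) ∧ ∀ w : InfinitePlace L, w α < T := by
  classical
  obtain ⟨w₀, hw₀⟩ : ∃ w : InfinitePlace L, IsReal w := by
    have := nrRealPlaces_pos_of_odd_finrank hodd
    obtain ⟨w⟩ := Fintype.card_pos_iff.1 this
    exact ⟨w.1, w.2⟩
  let f : InfinitePlace L → ℝ≥0 := fun w ↦ if w = w₀ then 1 / 2 else T
  have hf : ∏ w, f w ^ mult w = T ^ (finrank ℚ L - 1) / 2 := by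
    have hsum := sum_mult_eq (K := L)
    rw [← Finset.add_sum_erase _ _ (Finset.mem_univ w₀), mult_isReal ⟨w₀, hw₀⟩] at hsum
    rw [← Finset.mul_prod_erase _ _ (Finset.mem_univ w₀), mult_isReal ⟨w₀, hw₀⟩,
      Finset.prod_congr rfl (g := fun w ↦ T ^ mult w), Finset.prod_pow_eq_pow_sum]
    · simp only [f, if_true, ← hsum, Nat.add_sub_cancel_left]
      ring
    · intro w hw
      simp only [f, if_neg (Finset.ne_of_mem_erase hw)]
  have hvol : minkowskiBound L ↑1 < volume (convexBodyLT L f) := by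
    refine (minkowskiBound_one_le L).trans_lt ?_
    rw [convexBodyLT_volume]
    have h1 : (NNReal.sqrt ‖discr L‖₊ * 2 ^ finrank ℚ L : ℝ≥0) < ∏ w, f w ^ mult w := by
      rw [hf, lt_div_iff₀ two_pos, mul_assoc, ← pow_succ]
      exact h
    calc ((NNReal.sqrt ‖discr L‖₊ * 2 ^ finrank ℚ L : ℝ≥0) : ℝ≥0∞)
        < ((∏ w, f w ^ mult w : ℝ≥0) : ℝ≥0∞) := ENNReal.coe_lt_coe.2 h1
      _ ≤ _ := by
        push_cast
        exact le_mul_of_one_le_left (by positivity)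
          (ENNReal.one_le_coe_iff.2 (one_le_convexBodyLTFactor L))
  obtain ⟨α, hα, hw⟩ := exists_ne_zero_mem_ringOfIntegers_lt L hvol
  refine ⟨α, ?_, fun w ↦ (hw w).trans_le ?_⟩
  · rintro n rfl
    have hn : n ≠ 0 := by
      rintro rfl; simp at hα
    have h0 := hw w₀
    have h1 : w₀ ((n : 𝓞 L) : L) = |(n : ℝ)| := by
      rw [← w₀.norm_embedding_eq]
      simp
    rw [h1] at h0
    simp only [f, if_true] at h0
    have h2 : (1 : ℝ) ≤ |(n : ℝ)| := by
      exact_mod_cast Int.one_le_abs hn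
    norm_num at h0
    linarith
  · simp only [f]
    split_ifs
    · exact_mod_cast le_trans (by norm_num) hT
    · rfl

end Minkowski

section ConjugateFamily

open NumberField Module
open scoped NNReal

variable {N : Type*} [Field N] [NumberField N] [IsGalois ℚ N] {n : ℕ}
  (E : IntermediateField ℚ N) (ρ : Gal(N/ℚ) →* Equiv.Perm (Fin n)) (y₀ : Fin n)

theorem finrank_eq_of_stabilizer (hρ : ∀ y, ∃ g, ρ g y₀ = y)
    (hs : ∀ g, ρ g y₀ = y₀ ↔ g ∈ E.fixingSubgroup) : finrank ℚ E = n := by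
  have h := sum_galois_inv_apply E ρ y₀ hρ hs fun _ ↦ 1
  simp only [Finset.sum_const, Finset.card_univ, smul_eq_mul, mul_one,
    ← Nat.card_eq_fintype_card] at h
  rw [IsGaloisGroup.card_eq_finrank Gal(N/ℚ) ℚ N, ← finrank_mul_finrank ℚ E N, mul_comm,
    Nat.card_fin] at h
  exact Nat.eq_of_mul_eq_mul_left finrank_pos h

omit [IsGalois ℚ N] in
theorem exists_conjugates (hρ : ∀ y, ∃ g, ρ g y₀ = y)
    (hs : ∀ g, ρ g y₀ = y₀ ↔ g ∈ E.fixingSubgroup) (α : 𝓞 E) :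
    ∃ A : Fin n → 𝓞 N, A y₀ = algebraMap (𝓞 E) (𝓞 N) α ∧ ∀ g y, g • A y = A (ρ g y) := by
  choose g hg using hρ
  set a := algebraMap (𝓞 E) (𝓞 N) α with ha
  have hfix : ∀ τ, ρ τ y₀ = y₀ → τ • a = a := by
    intro τ hτ
    rw [hs] at hτ
    apply RingOfIntegers.ext
    exact hτ (α : E)
  have key : ∀ τ, g (ρ τ y₀) • a = τ • a := by
    intro τ
    rw [← inv_smul_eq_iff, smul_smul]
    apply hfix
    rw [map_mul, Equiv.Perm.mul_apply, hg, ← Equiv.Perm.mul_apply, ← map_mul]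
    simp
  refine ⟨fun y ↦ g y • a, hfix _ (hg y₀), fun τ y ↦ ?_⟩
  dsimp only
  conv_rhs => rw [← hg y, ← Equiv.Perm.mul_apply, ← map_mul, key, ← smul_smul]

/-- A field of degree `n` whose Galois group acts as the full symmetric group contains a small
integral generator of trace zero. -/
theorem exists_small_conjugates (hρ : Function.Surjective ρ)
    (hs : ∀ g, ρ g y₀ = y₀ ↔ g ∈ E.fixingSubgroup) (hodd : Odd n) {T : ℝ≥0} (hT : 1 ≤ T)
    (h : NNReal.sqrt ‖discr E‖₊ * 2 ^ (n + 1) < T ^ (n - 1)) :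
    ∃ β : Fin n → 𝓞 N, Function.Injective β ∧ (∀ g y, g • β y = β (ρ g y)) ∧ ∑ y, β y = 0 ∧
      ∀ (φ : N →+* ℂ) y, ‖φ (β y)‖ ≤ 2 * n * T := by
  have htrans : ∀ y, ∃ g, ρ g y₀ = y := fun y ↦ by
    obtain ⟨g, hg⟩ := hρ (Equiv.swap y₀ y)
    exact ⟨g, by simp [hg]⟩
  have hn := finrank_eq_of_stabilizer E ρ y₀ htrans hs
  obtain ⟨α, hα, hw⟩ := exists_ringOfIntegers_ne_intCast_forall_lt E (hn ▸ hodd) hT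
    (by rwa [hn])
  obtain ⟨A, hA0, hA⟩ := exists_conjugates E ρ y₀ htrans hs α
  have hn0 : (n : 𝓞 N) ≠ 0 := by
    rw [Nat.cast_ne_zero]; exact hodd.pos.ne'
  have hsum : ∀ g : Gal(N/ℚ), g • (∑ z, A z) = ∑ z, A z := fun g ↦ by
    rw [Finset.smul_sum, ← Equiv.sum_comp (ρ g) A]
    simp [hA]
  have hinj : Function.Injective A := by
    intro y z hyz
    by_contra hne
    have h1 : ∀ w, A w = A y := by
      intro w
      rcases eq_or_ne w y with rfl | hwy
      · rfl
      obtain ⟨g, hg⟩ := hρ (Equiv.swap z w)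
      have h2 := hA g y
      have h3 := hA g z
      rw [hg] at h2 h3
      rw [Equiv.swap_apply_of_ne_of_ne hne hwy.symm, hyz] at h2
      rw [Equiv.swap_apply_left] at h3
      rw [← h3, h2, hyz]
    obtain ⟨m, hm⟩ := Algebra.IsInvariant.isInvariant (A := ℤ) (G := Gal(N/ℚ)) (A y₀)
      fun g ↦ by rw [hA, h1, ← h1 y₀]
    apply hα m
    apply FaithfulSMul.algebraMap_injective (𝓞 E) (𝓞 N)
    rw [← hA0, ← hm]
    simp
  have hbound : ∀ (φ : N →+* ℂ) y, ‖φ (A y)‖ ≤ T := by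
    intro φ y
    obtain ⟨g, rfl⟩ := htrans y
    rw [← hA, hA0]
    let ψ : E →+* ℂ := φ.comp ((g : N →+* N).comp (algebraMap E N))
    exact (hw (InfinitePlace.mk ψ)).le
  refine ⟨fun y ↦ n * A y - ∑ z, A z, fun y z hyz ↦ ?_, fun g y ↦ ?_, ?_, fun φ y ↦ ?_⟩
  · simp only [sub_left_inj] at hyz
    exact hinj (mul_left_cancel₀ hn0 hyz)
  · rw [smul_sub, hsum, smul_mul', hA]
    congr 2
    exact map_natCast (MulSemiringAction.toRingHom Gal(N/ℚ) (𝓞 N) g) n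
  · simp [← Finset.mul_sum]
  · push_cast
    rw [map_sub, map_mul, map_natCast, map_sum]
    calc _ ≤ ‖(n : ℂ) * φ (A y)‖ + ‖∑ z, φ (A z)‖ := norm_sub_le _ _
      _ ≤ n * T + ∑ z : Fin n, (T : ℝ) := by
        gcongr
        · rw [norm_mul]
          simpa using mul_le_mul_of_nonneg_left (hbound φ y) (Nat.cast_nonneg n)
        · exact (norm_sum_le _ _).trans (Finset.sum_le_sum fun z _ ↦ hbound φ z)
      _ = 2 * n * T := by simp; ring

end ConjugateFamily

section IntegralQuintic

open NumberField Module Polynomial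

theorem coeff_quintic {R : Type*} [CommRing R] (a b c d : R) (i : ℕ) :
    (quintic a b c d).coeff i = if i = 5 then 1 else if i = 3 then a else if i = 2 then b
      else if i = 1 then c else if i = 0 then d else 0 := by
  simp only [quintic, coeff_add, coeff_X_pow, coeff_C_mul, coeff_C, coeff_X]
  rcases lt_or_ge 5 i with hi | hi
  · simp [show i ≠ 5 by lia, show i ≠ 3 by lia, show i ≠ 2 by lia, show i ≠ 1 by lia,
      show 1 ≠ i by lia, show i ≠ 0 by lia]
  · interval_cases i <;> simp

variable {N : Type*} [Field N] [NumberField N] [IsGalois ℚ N]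

theorem exists_quintic_map_eq_prod (ρ : Gal(N/ℚ) →* Equiv.Perm (Fin 5)) (β : Fin 5 → 𝓞 N)
    (hβ : ∀ g y, g • β y = β (ρ g y)) (h0 : ∑ y, β y = 0) :
    ∃ a b c d : ℤ, ∏ y, (X - C (β y)) = (quintic a b c d).map (algebraMap ℤ (𝓞 N)) := by
  set F : (𝓞 N)[X] := ∏ y, (X - C (β y)) with hF
  have hfix : ∀ g : Gal(N/ℚ), F.map (MulSemiringAction.toRingHom Gal(N/ℚ) (𝓞 N) g) = F := by
    intro g
    rw [hF, Polynomial.map_prod, ← Equiv.prod_comp (ρ g) fun y ↦ X - C (β y)]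
    refine Finset.prod_congr rfl fun y _ ↦ ?_
    rw [Polynomial.map_sub, map_X, map_C, MulSemiringAction.toRingHom_apply, hβ]
  have hcoeff : ∀ i, ∃ m : ℤ, algebraMap ℤ (𝓞 N) m = F.coeff i := fun i ↦
    Algebra.IsInvariant.isInvariant (A := ℤ) (G := Gal(N/ℚ)) _ fun g ↦ by
      conv_rhs => rw [← hfix g, coeff_map]
      rfl
  have hdeg : F.natDegree = 5 := by simp [hF]
  have hmonic : F.Monic := monic_prod_of_monic _ _ fun y _ ↦ monic_X_sub_C _
  have h4 : F.coeff 4 = 0 := by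
    have := prod_X_sub_C_coeff_card_pred Finset.univ β (by simp)
    rw [h0, neg_zero] at this
    exact this
  choose m hm using hcoeff
  refine ⟨m 3, m 2, m 1, m 0, ?_⟩
  rw [map_quintic, hm, hm, hm, hm]
  ext i
  rcases lt_or_ge 5 i with hi | hi
  · rw [coeff_eq_zero_of_natDegree_lt (hdeg ▸ hi)]
    simp [coeff_quintic, show i ≠ 5 by lia, show i ≠ 3 by lia, show i ≠ 2 by lia,
      show i ≠ 1 by lia, show i ≠ 0 by lia]
  · have h5 : F.coeff 5 = 1 := by rw [← hdeg]; exact hmonic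
    interval_cases i <;> simp [coeff_quintic, h4, h5]

omit [NumberField N] [IsGalois ℚ N] in
theorem abs_coeff_quintic_le {β : Fin 5 → 𝓞 N} {a b c d : ℤ} {R : ℝ}
    (h : ∏ y, (X - C (β y)) = (quintic a b c d).map (algebraMap ℤ (𝓞 N)))
    (φ : N →+* ℂ) (hφ : ∀ y, ‖φ (β y)‖ ≤ R) :
    |(a : ℝ)| ≤ 10 * R ^ 2 ∧ |(b : ℝ)| ≤ 10 * R ^ 3 ∧ |(c : ℝ)| ≤ 10 * R ^ 4 ∧
      |(d : ℝ)| ≤ 10 * R ^ 5 := by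
  have hR : 0 ≤ R := (norm_nonneg _).trans (hφ 0)
  set p : ℂ[X] := ∏ y, (X - C (φ (β y))) with hp
  have hpq : p = quintic (a : ℂ) b c d := by
    have := congrArg (Polynomial.map (φ.comp (algebraMap (𝓞 N) N))) h
    rw [Polynomial.map_prod, Polynomial.map_map, map_quintic] at this
    simpa using this
  have key : ∀ i, ‖(p.map (RingHom.id ℂ)).coeff i‖ ≤ R ^ (5 - i) * Nat.choose 5 i := by
    intro i
    have hd : p.natDegree = 5 := by simp [hp]
    have h1 := coeff_le_of_roots_le (f := RingHom.id ℂ) (p := p) (B := R) i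
      (monic_prod_of_monic _ _ fun y _ ↦ monic_X_sub_C _) (IsAlgClosed.splits _) (by
        intro z hz
        rw [Polynomial.map_id, hp, roots_prod _ _ (Finset.prod_ne_zero_iff.2 fun y _ ↦
          X_sub_C_ne_zero _)] at hz
        simp only [roots_X_sub_C, Multiset.mem_bind, Multiset.mem_singleton] at hz
        obtain ⟨y, -, rfl⟩ := hz
        exact hφ y)
    rwa [hd] at h1
  rw [Polynomial.map_id, hpq] at key
  have k0 := key 0
  have k1 := key 1
  have k2 := key 2
  have k3 := key 3
  simp [coeff_quintic, show Nat.choose 5 2 = 10 from rfl,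
    show Nat.choose 5 3 = 10 from rfl] at k0 k1 k2 k3
  have := pow_nonneg hR 4
  have := pow_nonneg hR 5
  refine ⟨?_, ?_, ?_, ?_⟩ <;> linarith

end IntegralQuintic

section LocalConditions

open NumberField Module Polynomial Ideal

variable {N : Type*} [Field N] [NumberField N] {p : ℕ} [hp : Fact p.Prime]

theorem exists_ringHom_algebraicClosure_ker (P : Ideal (𝓞 N)) [P.IsPrime]
    [hP : P.LiesOver (span {(p : ℤ)})] :
    ∃ π : 𝓞 N →+* AlgebraicClosure (ZMod p), ∀ x, π x = 0 ↔ x ∈ P := by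
  have : P.IsMaximal := Ideal.IsMaximal.of_liesOver_isMaximal P (span {(p : ℤ)})
  let _ : Field (𝓞 N ⧸ P) := Ideal.Quotient.field P
  have hP0 : P ≠ ⊥ := ne_bot_of_liesOver_of_ne_bot (span_prime_ne_bot (p := p)) P
  have : Finite (𝓞 N ⧸ P) := Ring.HasFiniteQuotients.finiteQuotient hP0
  have hmem : (p : 𝓞 N) ∈ P := by
    have : (p : ℤ) ∈ P.under ℤ := by
      rw [← hP.over]; exact Ideal.mem_span_singleton_self _
    simpa using this
  have : CharP (𝓞 N ⧸ P) p := by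
    refine (CharP.charP_iff_prime_eq_zero hp.out).2 ?_
    rw [← map_natCast (Ideal.Quotient.mk P)]
    exact Ideal.Quotient.eq_zero_iff_mem.2 hmem
  let _ : Algebra (ZMod p) (𝓞 N ⧸ P) := ZMod.algebra _ p
  have : Algebra.IsAlgebraic (ZMod p) (𝓞 N ⧸ P) := inferInstance
  let ι : (𝓞 N ⧸ P) →ₐ[ZMod p] AlgebraicClosure (ZMod p) := IsAlgClosed.lift
  refine ⟨(ι : (𝓞 N ⧸ P) →+* _).comp (Ideal.Quotient.mk P), fun x ↦ ?_⟩
  rw [RingHom.comp_apply, map_eq_zero_iff _ (RingHom.injective _), Ideal.Quotient.eq_zero_iff_mem]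

variable [IsGalois ℚ N]

/-- The integers `a`, `b`, `c`, `d` satisfy the congruence conditions modulo `p` which are forced
on the coefficients of a quintic defining a field whose discriminant has `p`-adic valuation `v`. -/
structure QuinticCongruences (v p : ℕ) [Fact p.Prime] (a b c d : ℤ) : Prop where
  mem_doubleRootsSet : 2 ≤ v → ((c : ZMod p), (d : ZMod p)) ∈ doubleRootsSet p (a : ZMod p) b
  dvd : v = 4 → (p : ℤ) ∣ b

theorem quinticCongruences (hp5 : 5 < p) (E : IntermediateField ℚ N)
    (ρ : Gal(N/ℚ) →* Equiv.Perm (Fin 5)) (y₀ : Fin 5)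
    (hρ : ∀ y, ∃ g, ρ g y₀ = y) (hs : ∀ g, ρ g y₀ = y₀ ↔ g ∈ E.fixingSubgroup)
    (ht : ¬ p ∣ finrank ℚ N) {β : Fin 5 → 𝓞 N} (hβ : ∀ g y, g • β y = β (ρ g y))
    (h0 : ∑ y, β y = 0) {a b c d : ℤ}
    (h : ∏ y, (X - C (β y)) = (quintic a b c d).map (algebraMap ℤ (𝓞 N))) :
    QuinticCongruences (padicValNat p (discr E).natAbs) p a b c d := by
  obtain ⟨P, hPmax, hP⟩ := exists_maximal_ideal_liesOver_of_isIntegral (S := 𝓞 N) (span {(p : ℤ)})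
  have hPp := hPmax.isPrime
  obtain ⟨π, hπ⟩ := exists_ringHom_algebraicClosure_ker (p := p) P
  have hinert : ∀ g ∈ P.inertia Gal(N/ℚ), ∀ y, π (β (ρ g y)) = π (β y) := by
    intro g hg y
    rw [← sub_eq_zero, ← map_sub, hπ, ← hβ]
    exact mem_inertia_galois_iff.1 hg _
  have hprod : ∏ y, (X - C (π (β y))) = quintic (a : AlgebraicClosure (ZMod p)) b c d := by
    have := congrArg (Polynomial.map π) h
    rw [Polynomial.map_prod, map_quintic, map_quintic] at this
    simpa using this
  constructor
  · intro htwo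
    obtain ⟨g, hg, h3⟩ := exists_three_le_card_support P E ρ y₀ hρ hs htwo ht
    refine mem_doubleRootsSet (ρ g) h3 (fun y ↦ π (β y)) (hinert g hg) ?_
    rw [hprod, map_quintic]
    simp
  · intro hfour
    have hconst : ∀ y, π (β y) = π (β y₀) := by
      intro y
      obtain ⟨g, hg, rfl⟩ := exists_inertia_apply_eq P E ρ y₀ hρ hs (by rw [hfour]) ht y
      exact hinert g hg y₀
    have hz : π (β y₀) = 0 := by
      have := congrArg π h0
      rw [map_sum, map_zero, Finset.sum_congr rfl fun y _ ↦ hconst y] at this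
      simp only [Finset.sum_const, Finset.card_univ, Fintype.card_fin, nsmul_eq_mul,
        mul_eq_zero] at this
      refine this.resolve_left fun h5 ↦ ?_
      rw [CharP.cast_eq_zero_iff _ p] at h5
      exact absurd (Nat.le_of_dvd (by norm_num) h5) (by lia)
    have hb := congrArg (coeff · 2) hprod
    simp only [hconst, hz, coeff_quintic] at hb
    simp [coeff_X_pow] at hb
    rw [eq_comm, CharP.intCast_eq_zero_iff _ p] at hb
    exact hb

end LocalConditions

section BoxCounting

open Finset

theorem card_filter_modEq_le {U : ℝ} {m : ℕ} (hm : m ≠ 0) (hU : 1 ≤ U) (hmU : m ≤ U) (r : ℤ) :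
    ((#{x ∈ Icc (-⌊U⌋) ⌊U⌋ | x ≡ r [ZMOD m]} : ℕ) : ℝ) ≤ 4 * U / m := by
  have hm0 : (0 : ℝ) < m := by positivity
  have h1 : Icc (-⌊U⌋) ⌊U⌋ = Ioc (-⌊U⌋ - 1) ⌊U⌋ := by
    ext x; simp only [mem_Icc, mem_Ioc]; lia
  rw [h1]
  have h2 := Int.Ioc_filter_modEq_card (-⌊U⌋ - 1) ⌊U⌋ (r := m) (by positivity) r
  have h3 : ((#{x ∈ Ioc (-⌊U⌋ - 1) ⌊U⌋ | x ≡ r [ZMOD m]} : ℤ) : ℝ) ≤ 4 * U / m := by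
    rw [h2, Int.cast_max, max_le_iff]
    refine ⟨?_, by push_cast; positivity⟩
    push_cast
    have h4 := Int.floor_le (((⌊U⌋ : ℚ) - r) / m)
    have h5 := Int.lt_floor_add_one (((-⌊U⌋ - 1 : ℚ) - r) / m)
    have h6 : ((⌊((⌊U⌋ : ℚ) - r) / m⌋ - ⌊((-⌊U⌋ - 1 : ℚ) - r) / m⌋ : ℤ) : ℚ) ≤
        (2 * ⌊U⌋ + 1) / m + 1 := by
      have : (2 * (⌊U⌋ : ℚ) + 1) / m = (⌊U⌋ - r) / m - (-⌊U⌋ - 1 - r) / m := by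
        rw [← sub_div]; ring
      push_cast
      rw [this]
      linarith
    have h7 : ((⌊((⌊U⌋ : ℚ) - r) / m⌋ - ⌊((-⌊U⌋ - 1 : ℚ) - r) / m⌋ : ℤ) : ℝ) ≤
        (2 * ⌊U⌋ + 1) / m + 1 := by exact_mod_cast h6
    push_cast at h7
    refine h7.trans ?_
    have h8 := Int.floor_le U
    rw [div_add_one hm0.ne']
    gcongr
    linarith
  exact_mod_cast h3

theorem natCast_modEq_of_forall_prime {B : ℕ} (hB : Squarefree B) {x y : ℤ}
    (h : ∀ p ∈ B.primeFactors, (x : ZMod p) = y) : x ≡ y [ZMOD B] := by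
  rw [← Nat.prod_primeFactors_of_squarefree hB, Int.modEq_iff_dvd]
  push_cast
  refine Finset.prod_dvd_of_coprime ?_ fun p hp ↦ ?_
  · intro p hp q hq hpq
    exact Nat.isCoprime_iff_coprime.2 ((Nat.coprime_primes (Nat.prime_of_mem_primeFactors hp)
      (Nat.prime_of_mem_primeFactors hq)).2 hpq)
  · rw [← Int.modEq_iff_dvd]
    exact (ZMod.intCast_eq_intCast_iff _ _ _).1 (h p hp)

open Classical in
theorem card_pairs_le {B : ℕ} (hB : Squarefree B)
    {D : ∀ p : ℕ, Set (ZMod p × ZMod p)} {k : ℕ} (hD : ∀ p ∈ B.primeFactors, (D p).ncard ≤ k)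
    {U V : ℝ} (hU : 1 ≤ U) (hV : 1 ≤ V) (hBU : B ≤ U) (hBV : B ≤ V) :
    ((#{x ∈ Icc (-⌊U⌋) ⌊U⌋ ×ˢ Icc (-⌊V⌋) ⌊V⌋ |
      ∀ p ∈ B.primeFactors, ((x.1 : ZMod p), (x.2 : ZMod p)) ∈ D p} : ℕ) : ℝ) ≤
      k ^ #B.primeFactors * (4 * U / B * (4 * V / B)) := by
  have (p : B.primeFactors) : NeZero (p : ℕ) := ⟨(Nat.prime_of_mem_primeFactors p.2).ne_zero⟩
  let T : Finset (∀ p : B.primeFactors, ZMod p × ZMod p) :=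
    Fintype.piFinset fun p ↦ (Set.toFinite (D p)).toFinset
  have hT : #T ≤ k ^ #B.primeFactors := by
    rw [Fintype.card_piFinset, ← Fintype.card_coe B.primeFactors, ← Finset.card_univ,
      ← Finset.prod_const]
    refine Finset.prod_le_prod' fun p _ ↦ ?_
    rw [← Set.ncard_eq_toFinset_card]
    exact hD p p.2
  let F : ℤ × ℤ → ∀ p : B.primeFactors, ZMod p × ZMod p := fun x p ↦ (x.1, x.2)
  set S := {x ∈ Icc (-⌊U⌋) ⌊U⌋ ×ˢ Icc (-⌊V⌋) ⌊V⌋ |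
      ∀ p ∈ B.primeFactors, ((x.1 : ZMod p), (x.2 : ZMod p)) ∈ D p} with hS
  have hF : ∀ x ∈ S, F x ∈ T := by
    intro x hx
    rw [hS, mem_filter] at hx
    simp only [T, Fintype.mem_piFinset, Set.Finite.mem_toFinset]
    exact fun p ↦ hx.2 p p.2
  rw [card_eq_sum_card_fiberwise hF]
  push_cast
  have hfib : ∀ t ∈ T, ((#{x ∈ S | F x = t} : ℕ) : ℝ) ≤ 4 * U / B * (4 * V / B) := by
    intro t _
    rcases Finset.eq_empty_or_nonempty {x ∈ S | F x = t} with he | ⟨x₀, hx₀⟩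
    · rw [he, card_empty, Nat.cast_zero]; positivity
    have hsub : {x ∈ S | F x = t} ⊆ {x ∈ Icc (-⌊U⌋) ⌊U⌋ | x ≡ x₀.1 [ZMOD B]} ×ˢ
        {x ∈ Icc (-⌊V⌋) ⌊V⌋ | x ≡ x₀.2 [ZMOD B]} := by
      intro x hx
      rw [mem_filter] at hx hx₀
      have hxx : F x = F x₀ := hx.2.trans hx₀.2.symm
      have hx1 := (mem_filter.1 hx.1).1
      rw [mem_product] at hx1 ⊢
      rw [mem_filter, mem_filter]
      exact ⟨⟨hx1.1, natCast_modEq_of_forall_prime hB fun p hp ↦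
          congrArg Prod.fst (congrFun hxx ⟨p, hp⟩)⟩,
        hx1.2, natCast_modEq_of_forall_prime hB fun p hp ↦
          congrArg Prod.snd (congrFun hxx ⟨p, hp⟩)⟩
    calc ((#{x ∈ S | F x = t} : ℕ) : ℝ) ≤ (_ : ℕ) := Nat.cast_le.2 (card_le_card hsub)
      _ ≤ _ := by
        rw [card_product]
        push_cast
        gcongr
        · exact card_filter_modEq_le hB.ne_zero hU hBU _
        · exact card_filter_modEq_le hB.ne_zero hV hBV _
  calc _ ≤ ∑ t ∈ T, (4 * U / B * (4 * V / B)) := Finset.sum_le_sum hfib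
    _ = #T * (4 * U / B * (4 * V / B)) := by rw [sum_const, nsmul_eq_mul]
    _ ≤ _ := by
      gcongr
      exact_mod_cast hT

end BoxCounting

section QuinticCounting

open Finset

open Classical in
/-- The integral quadruples in a box determined by `R` that satisfy a divisibility condition
modulo `m` and congruence conditions modulo the primes dividing `B`. -/
noncomputable def congruenceBox (D : ∀ p : ℕ, ZMod p → ZMod p → Set (ZMod p × ZMod p))
    (B m : ℕ) (R : ℝ) : Finset ((ℤ × ℤ) × ℤ × ℤ) :=
  {x ∈ (Icc (-⌊10 * R ^ 2⌋) ⌊10 * R ^ 2⌋ ×ˢ Icc (-⌊10 * R ^ 3⌋) ⌊10 * R ^ 3⌋) ×ˢ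
      Icc (-⌊10 * R ^ 4⌋) ⌊10 * R ^ 4⌋ ×ˢ Icc (-⌊10 * R ^ 5⌋) ⌊10 * R ^ 5⌋ |
    (m : ℤ) ∣ x.1.2 ∧ ∀ p ∈ B.primeFactors,
      ((x.2.1 : ZMod p), (x.2.2 : ZMod p)) ∈ D p (x.1.1 : ZMod p) (x.1.2 : ZMod p)}

theorem mem_congruenceBox {D : ∀ p : ℕ, ZMod p → ZMod p → Set (ZMod p × ZMod p)} {B m : ℕ} {R : ℝ}
    {a b c d : ℤ} : ((a, b), c, d) ∈ congruenceBox D B m R ↔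
      (|(a : ℝ)| ≤ 10 * R ^ 2 ∧ |(b : ℝ)| ≤ 10 * R ^ 3 ∧ |(c : ℝ)| ≤ 10 * R ^ 4 ∧
        |(d : ℝ)| ≤ 10 * R ^ 5) ∧ (m : ℤ) ∣ b ∧
      ∀ p ∈ B.primeFactors, ((c : ZMod p), (d : ZMod p)) ∈ D p (a : ZMod p) (b : ZMod p) := by
  have key : ∀ (x : ℤ) (U : ℝ), x ∈ Icc (-⌊U⌋) ⌊U⌋ ↔ |(x : ℝ)| ≤ U := by
    intro x U
    rw [mem_Icc, ← abs_le, Int.le_floor]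
    push_cast
    rfl
  simp only [congruenceBox, mem_filter, mem_product, key, and_assoc]

theorem card_congruenceBox_le {D : ∀ p : ℕ, ZMod p → ZMod p → Set (ZMod p × ZMod p)} {B m k : ℕ}
    {R : ℝ} (hB : Squarefree B) (hm : m ≠ 0) (hR : 1 ≤ R)
    (hD : ∀ p ∈ B.primeFactors, ∀ a b, (D p a b).ncard ≤ k) (hBR : B ≤ R ^ 4) (hmR : m ≤ R ^ 3) :
    (#(congruenceBox D B m R) : ℝ) ≤ 2560000 * k ^ #B.primeFactors * R ^ 14 / (m * B ^ 2) := by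
  classical
  have hB0 : (0 : ℝ) < B := by exact_mod_cast hB.ne_zero.bot_lt
  have hm0 : (0 : ℝ) < m := by exact_mod_cast hm.bot_lt
  have hpow : ∀ i, 1 ≤ 10 * R ^ i := fun i ↦ by
    linarith [one_le_pow₀ hR (n := i)]
  have h45 : R ^ 4 ≤ R ^ 5 := pow_le_pow_right₀ hR (by norm_num)
  set S := congruenceBox D B m R with hS
  let T : Finset (ℤ × ℤ) := {x ∈ Icc (-⌊10 * R ^ 2⌋) ⌊10 * R ^ 2⌋ | x ≡ 0 [ZMOD (1 : ℕ)]} ×ˢ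
    {x ∈ Icc (-⌊10 * R ^ 3⌋) ⌊10 * R ^ 3⌋ | x ≡ 0 [ZMOD m]}
  have hmaps : ∀ x ∈ S, x.1 ∈ T := by
    intro x hx
    rw [hS, congruenceBox, mem_filter, mem_product, mem_product] at hx
    simp only [T, mem_product, mem_filter]
    exact ⟨⟨hx.1.1.1, by simp [Int.modEq_one]⟩, hx.1.1.2, (Int.modEq_zero_iff_dvd).2 hx.2.1⟩
  have hT : (#T : ℝ) ≤ 4 * (10 * R ^ 2) / (1 : ℕ) * (4 * (10 * R ^ 3) / m) := by
    rw [card_product]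
    push_cast
    gcongr
    · exact_mod_cast card_filter_modEq_le one_ne_zero (hpow 2) (by simpa using hpow 2) 0
    · exact card_filter_modEq_le hm (hpow 3) (by linarith [hpow 3]) 0
  rw [card_eq_sum_card_fiberwise hmaps]
  push_cast
  have hfib : ∀ t ∈ T, (#{x ∈ S | x.1 = t} : ℝ) ≤
      k ^ #B.primeFactors * (4 * (10 * R ^ 4) / B * (4 * (10 * R ^ 5) / B)) := by
    intro t _
    refine le_trans ?_ (card_pairs_le hB (D := fun p ↦ D p (t.1 : ZMod p) (t.2 : ZMod p))
      (fun p hp ↦ hD p hp _ _) (hpow 4) (hpow 5) (by linarith [hpow 4]) (by linarith [hpow 4]))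
    refine Nat.cast_le.2 (card_le_card_of_injOn (fun x ↦ x.2) ?_ ?_)
    · intro x hx
      simp only [coe_filter, Set.mem_ofPred_eq, hS, congruenceBox, mem_filter, mem_product] at hx
      obtain ⟨⟨⟨-, hx1⟩, -, hx2⟩, rfl⟩ := hx
      simp only [coe_filter, Set.mem_ofPred_eq, mem_product]
      exact ⟨hx1, hx2⟩
    · intro x hx y hy hxy
      simp only [coe_filter, Set.mem_ofPred_eq] at hx hy
      exact Prod.ext (hx.2.trans hy.2.symm) hxy
  calc _ ≤ ∑ t ∈ T, k ^ #B.primeFactors * (4 * (10 * R ^ 4) / B * (4 * (10 * R ^ 5) / B)) :=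
        Finset.sum_le_sum hfib
    _ = #T * (k ^ #B.primeFactors * (4 * (10 * R ^ 4) / B * (4 * (10 * R ^ 5) / B))) := by
        rw [sum_const, nsmul_eq_mul]
    _ ≤ 4 * (10 * R ^ 2) / (1 : ℕ) * (4 * (10 * R ^ 3) / m) *
        (k ^ #B.primeFactors * (4 * (10 * R ^ 4) / B * (4 * (10 * R ^ 5) / B))) := by gcongr
    _ = _ := by push_cast; field_simp; ring

theorem exists_pow_card_primeFactors_le (k : ℕ) {δ : ℝ} (hδ : 0 < δ) :
    ∃ C : ℝ, 0 < C ∧ ∀ n : ℕ, n ≠ 0 → (k : ℝ) ^ #n.primeFactors ≤ C * (n : ℝ) ^ δ := by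
  have hlim : Filter.Tendsto (fun n : ℕ ↦ (n : ℝ) ^ δ) Filter.atTop Filter.atTop :=
    (tendsto_rpow_atTop hδ).comp tendsto_natCast_atTop_atTop
  obtain ⟨M, hM⟩ := Filter.eventually_atTop.1 (hlim.eventually_ge_atTop (k : ℝ))
  refine ⟨(k + 1) ^ M, by positivity, fun n hn ↦ ?_⟩
  have hk : (1 : ℝ) ≤ k + 1 := by linarith [Nat.cast_nonneg (α := ℝ) k]
  calc (k : ℝ) ^ #n.primeFactors = ∏ p ∈ n.primeFactors, (k : ℝ) := by rw [prod_const]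
    _ ≤ ∏ p ∈ n.primeFactors, ((if p < M then (k + 1 : ℝ) else 1) * (p : ℝ) ^ δ) := by
        refine prod_le_prod (fun _ _ ↦ by positivity) fun p hp ↦ ?_
        split_ifs with h
        · have h1 : (1 : ℝ) ≤ (p : ℝ) ^ δ := Real.one_le_rpow
            (by exact_mod_cast (Nat.prime_of_mem_primeFactors hp).one_le) hδ.le
          nlinarith
        · rw [one_mul]; exact hM p (not_lt.1 h)
    _ = (k + 1) ^ #{p ∈ n.primeFactors | p < M} * ((∏ p ∈ n.primeFactors, p : ℕ) : ℝ) ^ δ := by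
        rw [prod_mul_distrib, ← prod_filter, prod_const, Nat.cast_prod,
          Real.finsetProd_rpow _ _ fun _ _ ↦ by positivity]
    _ ≤ _ := by
        gcongr
        · calc #{p ∈ n.primeFactors | p < M} ≤ #(range M) := card_le_card fun p hp ↦
                mem_range.2 (mem_filter.1 hp).2
            _ = M := card_range M
        · exact Nat.le_of_dvd (Nat.pos_of_ne_zero hn) (Nat.prod_primeFactors_dvd n)

end QuinticCounting

section DiscriminantCounting

open Finset

theorem rpow_product_le {x y z w θ δ : ℝ} (hx : 1 ≤ x) (hy : 1 ≤ y) (hz : 1 ≤ z) (hw : 1 ≤ w)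
    (hθ : 1.423 ≤ θ) (hδ : δ ≤ 0.009) :
    (y * z * w) ^ δ * (x * y ^ 2 * z ^ 3 * w ^ 4) ^ (7 / 4 : ℝ) / (w * (y * z * w) ^ 2) ≤
      (x ^ 3 * y ^ 2 * z ^ 3 * w ^ 4) ^ θ *
        (x ^ (-1.01 : ℝ) * y ^ (-1.01 : ℝ) * z ^ (-1.01 : ℝ) * w ^ (-1.01 : ℝ)) := by
  have key : ∀ t : ℝ, 1 ≤ t → ∃ l, 0 ≤ l ∧ t = Real.exp l := fun t ht ↦
    ⟨Real.log t, Real.log_nonneg ht, (Real.exp_log (by linarith)).symm⟩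
  obtain ⟨i, hi, rfl⟩ := key x hx
  obtain ⟨j, hj, rfl⟩ := key y hy
  obtain ⟨k, hk, rfl⟩ := key z hz
  obtain ⟨l, hl, rfl⟩ := key w hw
  simp only [← Real.exp_nat_mul, ← Real.exp_add, ← Real.exp_mul, ← Real.exp_sub]
  rw [Real.exp_le_exp]
  push_cast
  nlinarith [mul_nonneg hi (sub_nonneg.2 hθ), mul_nonneg hj (sub_nonneg.2 hθ),
    mul_nonneg hk (sub_nonneg.2 hθ), mul_nonneg hl (sub_nonneg.2 hθ),
    mul_nonneg hj (sub_nonneg.2 hδ), mul_nonneg hk (sub_nonneg.2 hδ),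
    mul_nonneg hl (sub_nonneg.2 hδ)]

/-- The radicals of the parts of a discriminant with given exponents, where the discriminant of the
corresponding sextic field is at most `X`. -/
noncomputable def radicalTuples (X : ℝ) : Finset (ℕ × ℕ × ℕ × ℕ) :=
  {t ∈ Icc 1 ⌊X⌋₊ ×ˢ Icc 1 ⌊X⌋₊ ×ˢ Icc 1 ⌊X⌋₊ ×ˢ Icc 1 ⌊X⌋₊ |
    (t.1 ^ 3 * t.2.1 ^ 2 * t.2.2.1 ^ 3 * t.2.2.2 ^ 4 : ℝ) ≤ X ∧
    Squarefree (t.2.1 * t.2.2.1 * t.2.2.2) ∧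
    ∀ p ∈ (t.2.1 * t.2.2.1 * t.2.2.2).primeFactors, 5 < p}

theorem mem_radicalTuples {X : ℝ} {x y z w : ℕ} (hx : x ≠ 0) (hy : y ≠ 0) (hz : z ≠ 0) (hw : w ≠ 0)
    (hX : (x ^ 3 * y ^ 2 * z ^ 3 * w ^ 4 : ℝ) ≤ X) (hsq : Squarefree (y * z * w))
    (h5 : ∀ p ∈ (y * z * w).primeFactors, 5 < p) : (x, y, z, w) ∈ radicalTuples X := by
  have h1 : 0 < x ^ 3 := by positivity
  have h2 : 0 < y ^ 2 := by positivity
  have h3 : 0 < z ^ 3 := by positivity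
  have h4 : 0 < w ^ 4 := by positivity
  have key : ∀ m : ℕ, m ≠ 0 → m ≤ x ^ 3 * y ^ 2 * z ^ 3 * w ^ 4 → m ∈ Icc 1 ⌊X⌋₊ := by
    intro m hm hle
    rw [mem_Icc, Nat.le_floor_iff' hm]
    refine ⟨Nat.one_le_iff_ne_zero.2 hm, le_trans ?_ hX⟩
    exact_mod_cast hle
  have hle : ∀ m k : ℕ, k ≠ 0 → m ≤ m ^ k := fun m k hk ↦ Nat.le_self_pow hk m
  simp only [radicalTuples, mem_filter, mem_product]
  refine ⟨⟨key x hx ?_, key y hy ?_, key z hz ?_, key w hw ?_⟩, hX, hsq, h5⟩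
  · calc x ≤ x ^ 3 := hle x 3 (by norm_num)
      _ ≤ x ^ 3 * (y ^ 2 * z ^ 3 * w ^ 4) := Nat.le_mul_of_pos_right _ (by positivity)
      _ = _ := by ring
  · calc y ≤ y ^ 2 := hle y 2 (by norm_num)
      _ ≤ y ^ 2 * (x ^ 3 * z ^ 3 * w ^ 4) := Nat.le_mul_of_pos_right _ (by positivity)
      _ = _ := by ring
  · calc z ≤ z ^ 3 := hle z 3 (by norm_num)
      _ ≤ z ^ 3 * (x ^ 3 * y ^ 2 * w ^ 4) := Nat.le_mul_of_pos_right _ (by positivity)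
      _ = _ := by ring
  · calc w ≤ w ^ 4 := hle w 4 (by norm_num)
      _ ≤ w ^ 4 * (x ^ 3 * y ^ 2 * z ^ 3) := Nat.le_mul_of_pos_right _ (by positivity)
      _ = _ := by ring

/-- All candidates for the coefficients of a quintic polynomial together with the radicals. -/
noncomputable def quinticCandidates (D : ∀ p : ℕ, ZMod p → ZMod p → Set (ZMod p × ZMod p))
    (c X : ℝ) : Finset (Σ _ : ℕ × ℕ × ℕ × ℕ, (ℤ × ℤ) × ℤ × ℤ) :=
  (radicalTuples X).sigma fun t ↦ congruenceBox D (t.2.1 * t.2.2.1 * t.2.2.2) t.2.2.2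
    (c * (t.1 * t.2.1 ^ 2 * t.2.2.1 ^ 3 * t.2.2.2 ^ 4 : ℝ) ^ (1 / 8 : ℝ))

theorem exists_card_quinticCandidates_le {D : ∀ p : ℕ, ZMod p → ZMod p → Set (ZMod p × ZMod p)}
    {k : ℕ} (hD : ∀ p, p.Prime → 5 < p → ∀ a b, (D p a b).ncard ≤ k) {c θ : ℝ} (hc : 1 ≤ c)
    (hθ : 1.423 ≤ θ) :
    ∃ C : ℝ, 0 < C ∧ ∀ X : ℝ, 0 ≤ X → (#(quinticCandidates D c X) : ℝ) ≤ C * X ^ θ := by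
  obtain ⟨C, hC, hCk⟩ := exists_pow_card_primeFactors_le k (δ := 0.009) (by norm_num)
  have hsum : Summable fun n : ℕ ↦ (n : ℝ) ^ (-1.01 : ℝ) :=
    Real.summable_nat_rpow.2 (by norm_num)
  set S := ∑' n : ℕ, (n : ℝ) ^ (-1.01 : ℝ) with hS
  have hS0 : 0 < S := hsum.tsum_pos (fun n ↦ by positivity) 1 (by simp)
  refine ⟨2560000 * C * c ^ 14 * S ^ 4, by positivity, fun X hX ↦ ?_⟩
  rw [quinticCandidates, card_sigma]
  push_cast
  have hterm : ∀ t ∈ radicalTuples X, (#(congruenceBox D (t.2.1 * t.2.2.1 * t.2.2.2) t.2.2.2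
      (c * (t.1 * t.2.1 ^ 2 * t.2.2.1 ^ 3 * t.2.2.2 ^ 4 : ℝ) ^ (1 / 8 : ℝ))) : ℝ) ≤
      2560000 * C * c ^ 14 * X ^ θ * ((t.1 : ℝ) ^ (-1.01 : ℝ) * (t.2.1 : ℝ) ^ (-1.01 : ℝ) *
        (t.2.2.1 : ℝ) ^ (-1.01 : ℝ) * (t.2.2.2 : ℝ) ^ (-1.01 : ℝ)) := by
    rintro ⟨x, y, z, w⟩ ht
    simp only [radicalTuples, mem_filter, mem_product, mem_Icc] at ht ⊢
    obtain ⟨⟨⟨hx, -⟩, ⟨hy, -⟩, ⟨hz, -⟩, hw, -⟩, hle, hsq, h5⟩ := ht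
    have hx' : (1 : ℝ) ≤ x := by exact_mod_cast hx
    have hy' : (1 : ℝ) ≤ y := by exact_mod_cast hy
    have hz' : (1 : ℝ) ≤ z := by exact_mod_cast hz
    have hw' : (1 : ℝ) ≤ w := by exact_mod_cast hw
    set M : ℝ := x * y ^ 2 * z ^ 3 * w ^ 4 with hM
    have hM1 : 1 ≤ M := one_le_mul_of_one_le_of_one_le (one_le_mul_of_one_le_of_one_le
      (one_le_mul_of_one_le_of_one_le hx' (one_le_pow₀ hy')) (one_le_pow₀ hz')) (one_le_pow₀ hw')
    have hM0 : 0 ≤ M := by linarith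
    have hpow : ∀ i : ℕ, (M ^ (1 / 8 : ℝ)) ^ i = M ^ ((i : ℝ) / 8) := fun i ↦ by
      rw [← Real.rpow_natCast, ← Real.rpow_mul hM0]; ring_nf
    have hM8 : 1 ≤ M ^ (1 / 8 : ℝ) := Real.one_le_rpow hM1 (by norm_num)
    have hR : 1 ≤ c * M ^ (1 / 8 : ℝ) := one_le_mul_of_one_le_of_one_le hc hM8
    have hsqrt : ∀ (s : ℝ) (i : ℕ), 0 ≤ s → s ≤ (M ^ (1 / 8 : ℝ)) ^ i →
        s ≤ (c * M ^ (1 / 8 : ℝ)) ^ i := by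
      intro s i hs h
      rw [mul_pow]
      exact h.trans (le_mul_of_one_le_left (by positivity) (one_le_pow₀ hc))
    have hbox := card_congruenceBox_le (D := D) (B := y * z * w) (m := w) (k := k) hsq (by lia) hR
      (fun p hp ↦ hD p (Nat.prime_of_mem_primeFactors hp) (h5 p hp)) ?_ ?_
    · refine hbox.trans ?_
      have hk := hCk (y * z * w) hsq.ne_zero
      have hprod := rpow_product_le hx' hy' hz' hw' hθ (le_refl 0.009)
      rw [← hM] at hprod
      rw [mul_pow c, hpow]
      push_cast at hk ⊢
      calc _ ≤ 2560000 * (C * (y * z * w : ℝ) ^ (0.009 : ℝ)) * (c ^ 14 * M ^ ((14 : ℝ) / 8)) /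
            (w * (y * z * w : ℝ) ^ 2) := by gcongr
        _ = 2560000 * C * c ^ 14 * ((y * z * w : ℝ) ^ (0.009 : ℝ) * M ^ (7 / 4 : ℝ) /
            (w * (y * z * w : ℝ) ^ 2)) := by
          rw [show (14 : ℝ) / 8 = 7 / 4 by norm_num]; ring
        _ ≤ 2560000 * C * c ^ 14 * ((x ^ 3 * y ^ 2 * z ^ 3 * w ^ 4 : ℝ) ^ θ *
            ((x : ℝ) ^ (-1.01 : ℝ) * (y : ℝ) ^ (-1.01 : ℝ) * (z : ℝ) ^ (-1.01 : ℝ) *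
              (w : ℝ) ^ (-1.01 : ℝ))) := by gcongr
        _ ≤ 2560000 * C * c ^ 14 * (X ^ θ *
            ((x : ℝ) ^ (-1.01 : ℝ) * (y : ℝ) ^ (-1.01 : ℝ) * (z : ℝ) ^ (-1.01 : ℝ) *
              (w : ℝ) ^ (-1.01 : ℝ))) := by gcongr
        _ = _ := by ring
    · push_cast
      refine hsqrt _ 4 (by positivity) ?_
      rw [hpow, show ((4 : ℕ) : ℝ) / 8 = 1 / 2 by norm_num, ← Real.sqrt_eq_rpow]
      refine Real.le_sqrt_of_sq_le ?_
      calc (y * z * w : ℝ) ^ 2 = 1 * y ^ 2 * z ^ 2 * w ^ 2 := by ring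
        _ ≤ M := by
          rw [hM]
          gcongr
          · norm_num
          · norm_num
    · refine hsqrt _ 3 (by positivity) ?_
      rw [hpow]
      have h1 : (w : ℝ) ^ 4 ≤ M := by
        rw [hM]
        refine le_mul_of_one_le_left (by positivity) ?_
        exact one_le_mul_of_one_le_of_one_le
          (one_le_mul_of_one_le_of_one_le hx' (one_le_pow₀ hy')) (one_le_pow₀ hz')
      calc (w : ℝ) ≤ ((w : ℝ) ^ 4) ^ (((3 : ℕ) : ℝ) / 8) := by
            rw [← Real.rpow_natCast, ← Real.rpow_mul (by positivity)]
            conv_lhs => rw [← Real.rpow_one (w : ℝ)]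
            exact Real.rpow_le_rpow_of_exponent_le hw' (by norm_num)
        _ ≤ _ := by gcongr
  have hfin : ∑ n ∈ Icc 1 ⌊X⌋₊, (n : ℝ) ^ (-1.01 : ℝ) ≤ S :=
    hsum.sum_le_tsum _ fun n _ ↦ by positivity
  calc _ ≤ ∑ t ∈ radicalTuples X, 2560000 * C * c ^ 14 * X ^ θ *
        ((t.1 : ℝ) ^ (-1.01 : ℝ) * (t.2.1 : ℝ) ^ (-1.01 : ℝ) *
        (t.2.2.1 : ℝ) ^ (-1.01 : ℝ) * (t.2.2.2 : ℝ) ^ (-1.01 : ℝ)) := sum_le_sum hterm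
    _ ≤ ∑ t ∈ Icc 1 ⌊X⌋₊ ×ˢ Icc 1 ⌊X⌋₊ ×ˢ Icc 1 ⌊X⌋₊ ×ˢ Icc 1 ⌊X⌋₊,
        2560000 * C * c ^ 14 * X ^ θ *
        ((t.1 : ℝ) ^ (-1.01 : ℝ) * (t.2.1 : ℝ) ^ (-1.01 : ℝ) *
        (t.2.2.1 : ℝ) ^ (-1.01 : ℝ) * (t.2.2.2 : ℝ) ^ (-1.01 : ℝ)) :=
      sum_le_sum_of_subset_of_nonneg (filter_subset _ _) fun _ _ _ ↦ by positivity
    _ = 2560000 * C * c ^ 14 * X ^ θ * (∑ n ∈ Icc 1 ⌊X⌋₊, (n : ℝ) ^ (-1.01 : ℝ)) ^ 4 := by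
      simp only [← mul_sum, sum_product, mul_assoc, ← sum_mul]
      ring
    _ ≤ 2560000 * C * c ^ 14 * X ^ θ * S ^ 4 := by
      gcongr
    _ = _ := by ring

end DiscriminantCounting

section Radicals

open Finset

theorem prod_filter_primeFactors_pow (m : ℕ) (v F : ℕ → ℕ) (s : Finset ℕ)
    (hs : s = {p ∈ m.primeFactors | 5 < p ∧ v p ∈ Icc 1 4}) :
    ∏ p ∈ s, p ^ F (v p) =
      (∏ p ∈ s with v p = 1, p) ^ F 1 * (∏ p ∈ s with v p = 2, p) ^ F 2 *
      (∏ p ∈ s with v p = 3, p) ^ F 3 * (∏ p ∈ s with v p = 4, p) ^ F 4 := by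
  have hmaps : ∀ p ∈ s, v p ∈ Icc 1 4 := fun p hp ↦ by
    rw [hs, mem_filter] at hp; exact hp.2.2
  rw [← prod_fiberwise_of_maps_to hmaps]
  have hin : ∀ k, ∏ p ∈ s with v p = k, p ^ F (v p) = (∏ p ∈ s with v p = k, p) ^ F k := by
    intro k
    rw [← prod_pow]
    exact prod_congr rfl fun p hp ↦ by rw [(mem_filter.1 hp).2]
  simp only [hin, show (Icc 1 4 : Finset ℕ) = {1, 2, 3, 4} from rfl]
  rw [prod_insert (by simp), prod_insert (by simp), prod_insert (by simp), prod_singleton]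
  ring

/-- The decomposition of an integer into its small part and its parts with given exponents. -/
theorem exists_radicals {m n : ℕ} (hm : m ≠ 0) (hn : n ≠ 0)
    (hsmall : ∀ p, p.Prime → p ≤ 5 → padicValNat p m ≤ 20)
    (hlarge : ∀ p, p.Prime → 5 < p → padicValNat p m < 5)
    (hle : ∀ p, p.Prime → 5 < p → padicValNat p m ≤ padicValNat p n)
    (hone : ∀ p, p.Prime → 5 < p → padicValNat p m = 1 → padicValNat p n = 3) :
    ∃ x y z w : ℕ, x ≠ 0 ∧ Squarefree (y * z * w) ∧
      (∀ p ∈ (y * z * w).primeFactors, 5 < p ∧ 2 ≤ padicValNat p m) ∧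
      (∀ p ∈ w.primeFactors, padicValNat p m = 4) ∧
      x ^ 3 * y ^ 2 * z ^ 3 * w ^ 4 ≤ n ∧
      m ≤ 30 ^ 20 * (x * y ^ 2 * z ^ 3 * w ^ 4) := by
  set v : ℕ → ℕ := fun p ↦ padicValNat p m with hv
  set s : Finset ℕ := {p ∈ m.primeFactors | 5 < p ∧ v p ∈ Icc 1 4} with hs
  have hprime : ∀ p ∈ s, p.Prime := fun p hp ↦
    Nat.prime_of_mem_primeFactors (mem_filter.1 hp).1
  have hfac : ∀ k : ℕ, k ≠ 0 → ∏ p ∈ k.primeFactors, p ^ padicValNat p k = k := by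
    intro k hk
    conv_rhs => rw [← Nat.prod_factorization_pow_eq_self hk]
    exact prod_congr rfl fun p hp ↦ by
      rw [Nat.factorization_def k (Nat.prime_of_mem_primeFactors hp)]
  have hlower : ∏ p ∈ s, p ^ (if v p = 1 then 3 else v p) ≤ n := by
    have hsub : s ⊆ n.primeFactors := by
      intro p hp
      have hpp := hprime p hp
      rw [hs, mem_filter, mem_Icc] at hp
      have := hle p hpp hp.2.1
      rw [Nat.mem_primeFactors]
      have := Fact.mk hpp
      exact ⟨hpp, dvd_of_one_le_padicValNat (hp.2.2.1.trans ‹_›), hn⟩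
    calc ∏ p ∈ s, p ^ (if v p = 1 then 3 else v p)
        ≤ ∏ p ∈ s, p ^ padicValNat p n := by
          refine prod_le_prod' fun p hp ↦ Nat.pow_le_pow_right (hprime p hp).pos ?_
          have hpp := hprime p hp
          rw [hs, mem_filter, mem_Icc] at hp
          have h1 := hle p hpp hp.2.1
          have h3 := hone p hpp hp.2.1
          change v p ≤ _ at h1
          change v p = 1 → _ at h3
          split_ifs with h
          · exact (h3 h).ge
          · exact h1
      _ ≤ ∏ p ∈ n.primeFactors, p ^ padicValNat p n :=
          prod_le_prod_of_subset_of_one_le' hsub fun p hp _ ↦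
            Nat.one_le_pow _ _ (Nat.prime_of_mem_primeFactors hp).pos
      _ = n := hfac n hn
  have hupper : m ≤ 30 ^ 20 * ∏ p ∈ s, p ^ v p := by
    have hsplit : {p ∈ m.primeFactors | 5 < p} = s := by
      rw [hs]
      refine filter_congr fun p hp ↦ ?_
      have hpp := Nat.prime_of_mem_primeFactors hp
      have := Fact.mk hpp
      rw [mem_Icc]
      refine ⟨fun h5 ↦ ⟨h5, ?_, Nat.lt_succ_iff.1 (hlarge p hpp h5)⟩, fun h ↦ h.1⟩
      exact one_le_padicValNat_of_dvd hm (Nat.dvd_of_mem_primeFactors hp)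
    calc m = (∏ p ∈ m.primeFactors with ¬ 5 < p, p ^ v p) * ∏ p ∈ s, p ^ v p := by
          rw [← hsplit, mul_comm, prod_filter_mul_prod_filter_not, hfac m hm]
      _ ≤ _ := by
          refine Nat.mul_le_mul_right _ ?_
          calc ∏ p ∈ m.primeFactors with ¬ 5 < p, p ^ v p
              ≤ ∏ p ∈ m.primeFactors with ¬ 5 < p, p ^ 20 := by
                refine prod_le_prod' fun p hp ↦ ?_
                rw [mem_filter] at hp
                have hpp := Nat.prime_of_mem_primeFactors hp.1
                exact Nat.pow_le_pow_right hpp.pos (hsmall p hpp (not_lt.1 hp.2))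
            _ ≤ ∏ p ∈ ({2, 3, 5} : Finset ℕ), p ^ 20 := by
                refine prod_le_prod_of_subset_of_one_le' (fun p hp ↦ ?_) fun p hp _ ↦ ?_
                · rw [mem_filter] at hp
                  have hpp := Nat.prime_of_mem_primeFactors hp.1
                  have h5 := not_lt.1 hp.2
                  interval_cases p <;> simp_all +decide
                · refine Nat.one_le_pow _ _ ?_
                  simp only [mem_insert, mem_singleton] at hp
                  lia
            _ = 30 ^ 20 := by
                rw [prod_insert (by simp), prod_insert (by simp), prod_singleton]
                norm_num
  rw [prod_filter_primeFactors_pow m v (fun k ↦ if k = 1 then 3 else k) s hs] at hlower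
  norm_num at hlower
  have hid := prod_filter_primeFactors_pow m v id s hs
  simp only [id, pow_one] at hid
  rw [hid] at hupper
  have hprod : (∏ p ∈ s with v p = 2, p) * (∏ p ∈ s with v p = 3, p) *
      (∏ p ∈ s with v p = 4, p) = ∏ p ∈ s with 2 ≤ v p, p := by
    rw [← prod_union (disjoint_filter.2 (by lia)), ← filter_or,
      ← prod_union (disjoint_filter.2 (by lia)), ← filter_or]
    refine prod_congr (filter_congr fun p hp ↦ ?_) fun _ _ ↦ rfl
    rw [hs, mem_filter, mem_Icc] at hp
    lia
  have hpf : ∀ t ⊆ s, (∏ p ∈ t, p).primeFactors = t := fun t ht ↦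
    Nat.primeFactors_prod fun p hp ↦ hprime p (ht hp)
  refine ⟨∏ p ∈ s with v p = 1, p, ∏ p ∈ s with v p = 2, p, ∏ p ∈ s with v p = 3, p,
    ∏ p ∈ s with v p = 4, p, ?_, ?_, ?_, ?_, hlower, hupper⟩
  · exact prod_ne_zero_iff.2 fun p hp ↦ (hprime p (mem_filter.1 hp).1).ne_zero
  · rw [hprod]
    refine squarefree_prod_of_pairwise_isCoprime (fun p hp q hq hpq ↦ ?_) fun p hp ↦
      (hprime p (mem_filter.1 hp).1).prime.squarefree
    rw [Function.onFun_apply, ← Nat.coprime_iff_isRelPrime]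
    exact (Nat.coprime_primes (hprime p (mem_filter.1 hp).1) (hprime q (mem_filter.1 hq).1)).2 hpq
  · rw [hprod, hpf _ (filter_subset _ _)]
    intro p hp
    rw [mem_filter] at hp
    exact ⟨(mem_filter.1 hp.1).2.1, hp.2⟩
  · rw [hpf _ (filter_subset _ _)]
    exact fun p hp ↦ (mem_filter.1 hp).2

end Radicals

section QuinticData

open NumberField Module Polynomial Ideal
open scoped NNReal

/-- A version of `doubleRootsSet` defined for all natural numbers. -/
def doubleRootsSets (p : ℕ) (a b : ZMod p) : Set (ZMod p × ZMod p) :=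
  {x | ∃ _ : Fact p.Prime, x ∈ doubleRootsSet p a b}

theorem ncard_doubleRootsSets_le {p : ℕ} (hp : p.Prime) (hp5 : 5 < p) (a b : ZMod p) :
    (doubleRootsSets p a b).ncard ≤ 6 := by
  have := Fact.mk hp
  have h : doubleRootsSets p a b = doubleRootsSet p a b := by
    ext x; exact ⟨fun ⟨_, h⟩ ↦ h, fun h ↦ ⟨this, h⟩⟩
  rw [h]
  exact ncard_doubleRootsSet_le hp5 a b

variable {N : Type*} [Field N] [NumberField N] [IsGalois ℚ N]

theorem exists_radicals_of_bijective (hcard : finrank ℚ N = 120)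
    (ρ : Gal(N/ℚ) →* Equiv.Perm (Fin 5)) (hρ : Function.Bijective ρ)
    (θ : Gal(N/ℚ) →* Equiv.Perm (Fin 6)) (x₀ : Fin 6) (hθ : ∀ x, ∃ g, θ g x₀ = x)
    (E : IntermediateField ℚ N) (y₀ : Fin 5) (hs : ∀ g, ρ g y₀ = y₀ ↔ g ∈ E.fixingSubgroup)
    (E' : IntermediateField ℚ N) (hs' : ∀ g, θ g x₀ = x₀ ↔ g ∈ E'.fixingSubgroup)
    (hle : ∀ g, (ρ g).support.card ≤ (θ g).support.card)
    (h26 : ∀ g, (ρ g).support.card = 2 → (θ g).support.card = 6) :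
    ∃ x y z w : ℕ, x ≠ 0 ∧ Squarefree (y * z * w) ∧
      (∀ p ∈ (y * z * w).primeFactors, 5 < p ∧ 2 ≤ padicValNat p (discr E).natAbs) ∧
      (∀ p ∈ w.primeFactors, padicValNat p (discr E).natAbs = 4) ∧
      x ^ 3 * y ^ 2 * z ^ 3 * w ^ 4 ≤ (discr E').natAbs ∧
      (discr E).natAbs ≤ 30 ^ 20 * (x * y ^ 2 * z ^ 3 * w ^ 4) := by
  have htrans : ∀ y, ∃ g, ρ g y₀ = y := fun y ↦ by
    obtain ⟨g, hg⟩ := hρ.2 (Equiv.swap y₀ y)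
    exact ⟨g, by simp [hg]⟩
  have hnd : ∀ p : ℕ, p.Prime → 5 < p → ¬ p ∣ finrank ℚ N := by
    intro p hp h5 hdvd
    rw [hcard, show 120 = 2 ^ 3 * 3 * 5 by norm_num] at hdvd
    rcases (Nat.Prime.dvd_mul hp).1 hdvd with h | h
    · rcases (Nat.Prime.dvd_mul hp).1 h with h | h
      · exact absurd (Nat.le_of_dvd (by norm_num) (hp.dvd_of_dvd_pow h)) (by lia)
      · exact absurd (Nat.le_of_dvd (by norm_num) h) (by lia)
    · exact absurd (Nat.le_of_dvd (by norm_num) h) (by lia)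
  have hnd4 : ∀ p : ℕ, p.Prime → p ≤ 5 → ¬ p ^ 4 ∣ finrank ℚ N := by
    intro p hp h5
    rw [hcard]
    revert hp
    interval_cases p <;> norm_num
  refine exists_radicals (Int.natAbs_ne_zero.2 (discr_ne_zero E))
    (Int.natAbs_ne_zero.2 (discr_ne_zero E')) ?_ ?_ ?_ ?_
  · intro p hp h5
    have := Fact.mk hp
    obtain ⟨P, hPmax, hP⟩ :=
      exists_maximal_ideal_liesOver_of_isIntegral (S := 𝓞 N) (span {(p : ℤ)})
    have hPp := hPmax.isPrime
    have h := padicValNat_discr_mul_finrank_le P E (t := 4) (hnd4 p hp h5)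
    have hE := finrank_mul_finrank ℚ E N
    rw [finrank_eq_of_stabilizer E ρ y₀ htrans hs, hcard] at hE
    rw [hcard] at h
    have : finrank E N = 24 := by lia
    rw [this] at h
    lia
  all_goals
    intro p hp h5
    have := Fact.mk hp
    obtain ⟨P, hPmax, hP⟩ :=
      exists_maximal_ideal_liesOver_of_isIntegral (S := 𝓞 N) (span {(p : ℤ)})
    have hPp := hPmax.isPrime
  · exact padicValNat_discr_lt P E ρ y₀ htrans hs (hnd p hp h5)
  · exact padicValNat_discr_le_padicValNat_discr P E ρ y₀ E' θ x₀ htrans hs hθ hs'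
      (hnd p hp h5) hle
  · exact padicValNat_discr_eq_three P E ρ y₀ E' θ x₀ htrans hs hρ.1 hθ hs' (hnd p hp h5) h26

theorem exists_mem_quinticCandidates (hcard : finrank ℚ N = 120)
    (ρ : Gal(N/ℚ) →* Equiv.Perm (Fin 5)) (hρ : Function.Bijective ρ)
    (θ : Gal(N/ℚ) →* Equiv.Perm (Fin 6)) (x₀ : Fin 6) (hθ : ∀ x, ∃ g, θ g x₀ = x)
    (E' : IntermediateField ℚ N) (hs' : ∀ g, θ g x₀ = x₀ ↔ g ∈ E'.fixingSubgroup)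
    (hle : ∀ g, (ρ g).support.card ≤ (θ g).support.card)
    (h26 : ∀ g, (ρ g).support.card = 2 → (θ g).support.card = 6)
    {X : ℝ} (hX : |(discr E' : ℝ)| ≤ X) :
    ∃ q ∈ quinticCandidates doubleRootsSets (10 ^ 7) X, ∃ β : Fin 5 → 𝓞 N,
      Function.Injective β ∧ (∀ g y, g • β y = β (ρ g y)) ∧
      ∏ y, (Polynomial.X - C (β y)) =
        (quintic q.2.1.1 q.2.1.2 q.2.2.1 q.2.2.2).map (algebraMap ℤ (𝓞 N)) := by
  let H : Subgroup Gal(N/ℚ) := (MulAction.stabilizer (Equiv.Perm (Fin 5)) (0 : Fin 5)).comap ρ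
  let E : IntermediateField ℚ N := IntermediateField.fixedField H
  have hs : ∀ g, ρ g 0 = 0 ↔ g ∈ E.fixingSubgroup := by
    intro g
    rw [IntermediateField.fixingSubgroup_fixedField]
    rfl
  have htrans : ∀ y, ∃ g, ρ g 0 = y := fun y ↦ by
    obtain ⟨g, hg⟩ := hρ.2 (Equiv.swap 0 y)
    exact ⟨g, by simp [hg]⟩
  obtain ⟨x, y, z, w, hx, hsq, h2, h4, hD', hD⟩ :=
    exists_radicals_of_bijective hcard ρ hρ θ x₀ hθ E 0 hs E' hs' hle h26
  have hyzw := hsq.ne_zero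
  have hw : w ≠ 0 := right_ne_zero_of_mul hyzw
  have hy : y ≠ 0 := left_ne_zero_of_mul (left_ne_zero_of_mul hyzw)
  have hz : z ≠ 0 := right_ne_zero_of_mul (left_ne_zero_of_mul hyzw)
  set M : ℝ≥0 := x * y ^ 2 * z ^ 3 * w ^ 4 with hM
  have hM1 : 1 ≤ M := by
    have : 0 < x * y ^ 2 * z ^ 3 * w ^ 4 := by positivity
    rw [hM]
    exact_mod_cast this
  set T : ℝ≥0 := 10 ^ 6 * M ^ (1 / 8 : ℝ) with hT
  have hM8 : 1 ≤ M ^ (1 / 8 : ℝ) := NNReal.one_le_rpow hM1 (by norm_num)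
  have hT1 : 1 ≤ T := one_le_mul_of_one_le_of_one_le (by norm_num) hM8
  have hdiscr : ‖discr E‖₊ ≤ 30 ^ 20 * M := by
    rw [← NNReal.natCast_natAbs, hM]
    exact_mod_cast hD
  have hlt : NNReal.sqrt ‖discr E‖₊ * 2 ^ (5 + 1) < T ^ (5 - 1) := by
    have hM4 : (M ^ (1 / 8 : ℝ)) ^ 4 = NNReal.sqrt M := by
      rw [NNReal.sqrt_eq_rpow, ← NNReal.rpow_natCast, ← NNReal.rpow_mul]
      norm_num
    have hsqrt : NNReal.sqrt ‖discr E‖₊ ≤ 30 ^ 10 * NNReal.sqrt M := by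
      refine (NNReal.sqrt_le_sqrt.2 hdiscr).trans ?_
      rw [NNReal.sqrt_mul, show (30 : ℝ≥0) ^ 20 = (30 ^ 10) ^ 2 by norm_num, NNReal.sqrt_sq]
    have hpos : 0 < NNReal.sqrt M := NNReal.sqrt_pos.2 (zero_lt_one.trans_le hM1)
    calc _ ≤ 30 ^ 10 * NNReal.sqrt M * 2 ^ (5 + 1) := by gcongr
      _ = 30 ^ 10 * 2 ^ 6 * NNReal.sqrt M := by ring
      _ < 10 ^ 24 * NNReal.sqrt M := by
        refine mul_lt_mul_of_pos_right ?_ hpos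
        norm_num
      _ = _ := by rw [hT, mul_pow, hM4]; norm_num
  obtain ⟨β, hinj, hβ, h0, hbound⟩ :=
    exists_small_conjugates E ρ 0 hρ.2 hs (by decide) hT1 hlt
  obtain ⟨a, b, c, d, hprod⟩ := exists_quintic_map_eq_prod ρ β hβ h0
  have hcong : ∀ p : ℕ, 5 < p → ∀ _ : Fact p.Prime,
      QuinticCongruences (padicValNat p (discr E).natAbs) p a b c d := by
    intro p hp5 hp
    refine quinticCongruences hp5 E ρ 0 htrans hs ?_ hβ h0 hprod
    intro hdvd
    rw [hcard, show 120 = 2 ^ 3 * 3 * 5 by norm_num] at hdvd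
    rcases (Nat.Prime.dvd_mul hp.out).1 hdvd with h | h
    · rcases (Nat.Prime.dvd_mul hp.out).1 h with h | h
      · exact absurd (Nat.le_of_dvd (by norm_num) (hp.out.dvd_of_dvd_pow h)) (by lia)
      · exact absurd (Nat.le_of_dvd (by norm_num) h) (by lia)
    · exact absurd (Nat.le_of_dvd (by norm_num) h) (by lia)
  refine ⟨⟨(x, y, z, w), (a, b), c, d⟩, ?_, β, hinj, hβ, hprod⟩
  rw [quinticCandidates, Finset.mem_sigma]
  refine ⟨mem_radicalTuples hx hy hz hw ?_ hsq fun p hp ↦ (h2 p hp).1, ?_⟩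
  · refine le_trans ?_ hX
    rw [← Int.cast_abs, Int.abs_eq_natAbs]
    exact_mod_cast hD'
  · rw [mem_congruenceBox]
    refine ⟨?_, ?_, ?_⟩
    · obtain ⟨φ⟩ : Nonempty (N →+* ℂ) := inferInstance
      have hR : 2 * (5 : ℕ) * (T : ℝ) =
          10 ^ 7 * (x * y ^ 2 * z ^ 3 * w ^ 4 : ℝ) ^ (1 / 8 : ℝ) := by
        rw [hT, hM]
        push_cast
        ring
      rw [← hR]
      exact abs_coeff_quintic_le hprod φ (hbound φ)
    · have hwsq : Squarefree w := hsq.squarefree_of_dvd (Dvd.intro_left _ rfl)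
      rw [← Int.modEq_zero_iff_dvd]
      refine natCast_modEq_of_forall_prime hwsq fun p hp ↦ ?_
      have hp5 := (h2 p (Nat.primeFactors_mono (Dvd.intro_left _ rfl) hyzw hp)).1
      have := Fact.mk (Nat.prime_of_mem_primeFactors hp)
      rw [Int.cast_zero, ZMod.intCast_zmod_eq_zero_iff_dvd]
      exact (hcong p hp5 this).dvd (h4 p hp)
    · intro p hp
      have := Fact.mk (Nat.prime_of_mem_primeFactors hp)
      exact ⟨this, (hcong p (h2 p hp).1 this).mem_doubleRootsSet (h2 p hp).2⟩

end QuinticData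

section GaloisAction

open NumberField Module IntermediateField

section General

variable {F L : Type*} [Field F] [Field L] [Algebra F L]

theorem restrictNormal_coe_apply (N : IntermediateField F L) [Normal F N]
    (g : L ≃ₐ[F] L) (x : N) : ((g.restrictNormal N x : N) : L) = g x :=
  g.restrictNormal_commutes N x

theorem forall_comp_eq_iff_restrictNormal_eq_one [Normal F L] {K : IntermediateField F L}
    (g : L ≃ₐ[F] L) :
    (∀ ι : K →ₐ[F] L, g.toAlgHom.comp ι = ι) ↔ g.restrictNormal (normalClosure F K L) = 1 := by
  constructor
  · intro h
    have hN : normalClosure F K L ≤ fixedField (Subgroup.zpowers g) := by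
      rw [normalClosure_le_iff]
      rintro ι _ ⟨x, rfl⟩
      have hx : g (ι x) = ι x := DFunLike.congr_fun (h ι) x
      change ι x ∈ _
      rw [mem_fixedField_iff]
      intro f hf
      have : Subgroup.zpowers g ≤ MulAction.stabilizer (L ≃ₐ[F] L) (ι x) := by
        rw [Subgroup.zpowers_le]
        exact hx
      exact this hf
    ext x
    rw [restrictNormal_coe_apply]
    exact (mem_fixedField_iff _ _).1 (hN x.2) g (Subgroup.mem_zpowers g)
  · intro h ι
    ext x
    have hx : ι x ∈ normalClosure F K L := ι.fieldRange_le_normalClosure ⟨x, rfl⟩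
    have := restrictNormal_coe_apply _ g ⟨_, hx⟩
    rw [h] at this
    exact this.symm

/-- An action of the Galois group of `L` on a set identified with the embeddings of `K` factors
through a faithful action of the Galois group of the normal closure, in which a point stabilizer is
the group fixing `K`. -/
theorem exists_isGalois_hom [IsGalois F L] {K : IntermediateField F L}
    [FiniteDimensional F K] {S : Type*}
    (e : (K →ₐ[F] L) ≃ S) (α : (L ≃ₐ[F] L) →* Equiv.Perm S)
    (hα : ∀ g ι, α g (e ι) = e (g.toAlgHom.comp ι)) :
    ∃ (N : IntermediateField F L) (hle : K ≤ N), FiniteDimensional F N ∧ IsGalois F N ∧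
      ∃ θ : Gal(N/F) →* Equiv.Perm S, Function.Injective θ ∧ θ.range = α.range ∧
        ∀ g, θ g (e K.val) = e K.val ↔ g ∈ (restrict hle).fixingSubgroup := by
  set N := normalClosure F K L
  let π := AlgEquiv.restrictNormalHom (F := F) (K₁ := L) N
  have hπ : Function.Surjective π := AlgEquiv.restrictNormalHom_surjective L
  have hker : ∀ g, α g = 1 ↔ π g = 1 := by
    intro g
    refine Iff.trans ?_ (forall_comp_eq_iff_restrictNormal_eq_one (K := K) g)
    rw [Equiv.ext_iff, ← e.forall_congr_right]
    simp [hα]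
  let θ := π.liftOfSurjective hπ ⟨α, fun g hg ↦ (hker g).2 hg⟩
  have hθ : ∀ g, θ (π g) = α g := fun g ↦
    MonoidHom.liftOfRightInverse_comp_apply _ _ _ _ g
  refine ⟨N, K.le_normalClosure, inferInstance, ⟨⟩, θ, ?_, ?_, ?_⟩
  · rw [injective_iff_map_eq_one]
    intro g hg
    obtain ⟨g, rfl⟩ := hπ g
    rw [hθ] at hg
    exact (hker g).1 hg
  · ext σ
    constructor
    · rintro ⟨g, rfl⟩
      obtain ⟨g, rfl⟩ := hπ g
      exact ⟨g, (hθ g).symm⟩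
    · rintro ⟨g, rfl⟩
      exact ⟨π g, hθ g⟩
  · intro g
    obtain ⟨g, rfl⟩ := hπ g
    rw [hθ, hα, e.injective.eq_iff, IntermediateField.mem_fixingSubgroup_iff]
    constructor
    · intro h x hx
      rw [mem_restrict] at hx
      have : g (x : L) = x := DFunLike.congr_fun h ⟨x, hx⟩
      exact Subtype.ext ((restrictNormal_coe_apply N g x).trans this)
    · intro h
      ext x
      have hx := h ⟨x, K.le_normalClosure x.2⟩ ((mem_restrict _ _).2 x.2)
      have := restrictNormal_coe_apply N g ⟨x, K.le_normalClosure x.2⟩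
      exact this.symm.trans (congrArg Subtype.val hx)

theorem eq_adjoin_rootSet {N : IntermediateField F L} [FiniteDimensional F N] [IsGalois F N]
    {ι : Type*} [Fintype ι] {P : Polynomial F} {β : ι → N}
    (hβ : ∀ g : Gal(N/F), (∀ i, g (β i) = β i) → g = 1)
    (hP : P.map (algebraMap F L) = ∏ i, (Polynomial.X - Polynomial.C (β i : L))) :
    N = adjoin F (P.rootSet L) := by
  have htop : adjoin F (Set.range β) = ⊤ := by
    rw [← IsGalois.fixedField_fixingSubgroup (adjoin F _), ← fixedField_bot]
    congr 1
    rw [eq_bot_iff]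
    intro g hg
    exact hβ g fun i ↦ (mem_fixingSubgroup_iff _ _).1 hg _ (subset_adjoin _ _ ⟨i, rfl⟩)
  have hroot : P.rootSet L = N.val '' Set.range β := by
    have hne : ∏ i, (Polynomial.X - Polynomial.C (β i : L)) ≠ 0 :=
      (Polynomial.monic_prod_of_monic _ _ fun i _ ↦ Polynomial.monic_X_sub_C _).ne_zero
    ext z
    rw [Polynomial.mem_rootSet', ← Polynomial.eval_map_algebraMap, hP, Polynomial.eval_prod,
      Finset.prod_eq_zero_iff, ← Set.range_comp]
    simp only [hne, sub_eq_zero, eq_comm (a := z), ne_eq, not_false_eq_true, true_and,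
      Polynomial.eval_sub, Polynomial.eval_X, Polynomial.eval_C, Finset.mem_univ]
    rfl
  rw [hroot, ← adjoin_map, htop, ← AlgHom.fieldRange_eq_map, fieldRange_val]

theorem card_le_two_pow_of_forall_le {M : IntermediateField F L} [FiniteDimensional F M]
    [IsGalois F M] (s : Finset (IntermediateField F L)) (hs : ∀ K ∈ s, K ≤ M) :
    s.card ≤ 2 ^ finrank F M := by
  classical
  let f : s → Set Gal(M/F) := fun K ↦ (restrict (hs K K.2)).fixingSubgroup
  have hf : Function.Injective f := by
    intro K K' h
    have h' : restrict (hs K K.2) = restrict (hs K' K'.2) := by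
      rw [← IsGalois.fixedField_fixingSubgroup (restrict (hs K K.2)),
        ← IsGalois.fixedField_fixingSubgroup (restrict (hs K' K'.2)), SetLike.coe_injective h]
    apply Subtype.ext
    rw [← lift_restrict (hs K K.2), h', lift_restrict]
  have := Nat.card_le_card_of_injective f hf
  rwa [Nat.card_eq_fintype_card, Fintype.card_coe, Nat.card_eq_fintype_card (α := Set _),
    Fintype.card_set, ← Nat.card_eq_fintype_card, IsGalois.card_aut_eq_finrank] at this

end General

/-- The splitting field in `Qbar` of the polynomial underlying a candidate. -/
noncomputable def candidateField (q : Σ _ : ℕ × ℕ × ℕ × ℕ, (ℤ × ℤ) × ℤ × ℤ) :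
    IntermediateField ℚ Qbar :=
  adjoin ℚ ((quintic (q.2.1.1 : ℚ) q.2.1.2 q.2.2.1 q.2.2.2).rootSet Qbar)

/-- A Galois extension of the rationals with the given Galois group is generated by the roots of
one of the candidate quintic polynomials. -/
theorem exists_quintic_map_eq_prod_of_range_eq {N : Type*} [Field N] [NumberField N] [Algebra ℚ N]
    [IsGalois ℚ N] {G : Subgroup (Equiv.Perm (Fin 6))} (htrans : IsTransitiveSub G)
    (hcard : Nat.card G = 120) {θ : Gal(N/ℚ) →* Equiv.Perm (Fin 6)} (hinj : Function.Injective θ)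
    (hrange : θ.range = G) {x₀ : Fin 6} {E : IntermediateField ℚ N}
    (hstab : ∀ g, θ g x₀ = x₀ ↔ g ∈ E.fixingSubgroup) {B : ℝ} (hB : |(discr E : ℝ)| ≤ B) :
    finrank ℚ N = 120 ∧ ∃ q ∈ quinticCandidates doubleRootsSets (10 ^ 7) B, ∃ β : Fin 5 → N,
      (∀ g : Gal(N/ℚ), (∀ y, g (β y) = β y) → g = 1) ∧
      (quintic (q.2.1.1 : ℚ) q.2.1.2 q.2.2.1 q.2.2.2).map (algebraMap ℚ N) =
        ∏ y, (Polynomial.X - Polynomial.C (β y)) := by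
  rename_i inst _
  obtain rfl : inst = DivisionRing.toRatAlgebra := Subsingleton.elim _ _
  subst hrange
  have hbij : Function.Bijective θ.rangeRestrict :=
    ⟨MonoidHom.rangeRestrict_injective_iff.2 hinj, θ.rangeRestrict_surjective⟩
  have hfinrank : finrank ℚ N = 120 := by
    rw [← IsGalois.card_aut_eq_finrank, Nat.card_eq_of_bijective _ hbij, hcard]
  obtain ⟨ψ, hψ, hψ1, hψ2⟩ := exists_hom_perm_fin_five htrans hcard
  obtain ⟨q, hq, β, hβ, hact, hprod⟩ := exists_mem_quinticCandidates hfinrank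
    (ψ.comp θ.rangeRestrict) (hψ.comp hbij) θ x₀ (fun x ↦ by
      obtain ⟨_, ⟨g, rfl⟩, h⟩ := htrans x₀ x
      exact ⟨g, h⟩) E hstab (fun g ↦ hψ1 _) (fun g ↦ hψ2 _) hB
  refine ⟨hfinrank, q, hq, fun y ↦ β y, fun g hg ↦ ?_, ?_⟩
  · refine (injective_iff_map_eq_one (ψ.comp θ.rangeRestrict)).1 (hψ.comp hbij).1 g
      (Equiv.ext fun y ↦ hβ ?_)
    exact (hact g y).symm.trans (RingOfIntegers.ext (hg y))
  · have := congrArg (Polynomial.map (algebraMap (𝓞 N) N)) hprod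
    rw [Polynomial.map_map, map_quintic, Polynomial.map_prod] at this
    simpa [map_quintic] using this.symm

/-- A sextic field with the given Galois group lies in the splitting field of one of the candidate
quintic polynomials. -/
theorem exists_le_candidateField {K : IntermediateField ℚ Qbar} {G : Subgroup (Equiv.Perm (Fin 6))}
    (htrans : IsTransitiveSub G) (hcard : Nat.card G = 120) (hK : finrank ℚ K = 6)
    {B : ℝ} (hB : |(fieldDiscr K : ℝ)| ≤ B) (hG : HasGalGroup 6 K G) :
    ∃ q ∈ quinticCandidates doubleRootsSets (10 ^ 7) B,
      IsGalois ℚ (candidateField q) ∧ finrank ℚ (candidateField q) = 120 ∧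
      K ≤ candidateField q := by
  have hfin : FiniteDimensional ℚ K := .of_finrank_pos (by lia)
  have : NumberField K := ⟨⟩
  have : IsAlgClosure ℚ Qbar := ⟨inferInstance, AlgebraicClosure.isAlgebraic ℚ⟩
  have : IsGalois ℚ Qbar := { to_normal := IsAlgClosure.normal ℚ Qbar }
  obtain ⟨e, he⟩ := hG
  let α : (Qbar ≃ₐ[ℚ] Qbar) →* Equiv.Perm (Fin 6) :=
    (e.permCongrHom : Equiv.Perm (K →ₐ[ℚ] Qbar) →* Equiv.Perm (Fin 6)).comp (galAct K)
  have hα : ∀ g ι, α g (e ι) = e (g.toAlgHom.comp ι) := by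
    intro g ι
    change e (galAct K g (e.symm (e ι))) = _
    rw [e.symm_apply_apply]
    rfl
  obtain ⟨N, hle, _, hgal, θ, hinj, hrange, hstab⟩ := exists_isGalois_hom (K := K) e α hα
  have hrange' : θ.range = G := by
    rw [hrange]
    ext σ
    exact (he σ).symm
  have : NumberField N := { to_charZero := inferInstance }
  have hdiscr : discr (restrict hle) = fieldDiscr K := by
    rw [fieldDiscr, dif_pos hfin]
    exact (discr_eq_discr_of_ringEquiv K (restrictAlgEquiv hle).toRingEquiv).symm
  obtain ⟨hfinrank, q, hq, β, hβ, hprod⟩ := exists_quintic_map_eq_prod_of_range_eq htrans hcard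
    hinj hrange' hstab (B := B) (by rwa [hdiscr])
  have hN : N = candidateField q := by
    refine eq_adjoin_rootSet hβ ?_
    have := congrArg (Polynomial.map (algebraMap N Qbar)) hprod
    rw [Polynomial.map_map, ← IsScalarTower.algebraMap_eq, Polynomial.map_prod] at this
    simpa using this
  subst hN
  exact ⟨q, hq, hgal, hfinrank, hle⟩

theorem FnG_le {G : Subgroup (Equiv.Perm (Fin 6))} (htrans : IsTransitiveSub G)
    (hcard : Nat.card G = 120) (B : ℝ) :
    FnG 6 B G ≤ 2 ^ 120 * (quinticCandidates doubleRootsSets (10 ^ 7) B).card := by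
  classical
  set S : Set (IntermediateField ℚ Qbar) :=
    {K | finrank ℚ K = 6 ∧ |(fieldDiscr K : ℝ)| ≤ B ∧ HasGalGroup 6 K G}
  have hFnG : FnG 6 B G = Nat.card S := rfl
  rw [hFnG]
  obtain hinf | hfin : Infinite S ∨ S.Finite := (finite_or_infinite S).symm
  · simp
  have hq : ∀ K ∈ S, ∃ q ∈ quinticCandidates doubleRootsSets (10 ^ 7) B,
      IsGalois ℚ (candidateField q) ∧ finrank ℚ (candidateField q) = 120 ∧
      K ≤ candidateField q :=
    fun K hK ↦ exists_le_candidateField htrans hcard hK.1 hK.2.1 hK.2.2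
  choose! q hmem hgal hdeg hle using hq
  rw [Nat.card_eq_card_finite_toFinset hfin]
  refine Finset.card_le_mul_card_image_of_maps_to (f := q)
    (fun K hK ↦ hmem K (hfin.mem_toFinset.1 hK))
    _ fun r _ ↦ ?_
  obtain hempty | ⟨K₀, hK₀⟩ :=
    {K ∈ hfin.toFinset | q K = r}.eq_empty_or_nonempty
  · simp [hempty]
  obtain ⟨hmemK₀, rfl⟩ := Finset.mem_filter.1 hK₀
  have hK₀' : K₀ ∈ S := hfin.mem_toFinset.1 hmemK₀
  have : FiniteDimensional ℚ (candidateField (q K₀)) :=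
    .of_finrank_pos (by rw [hdeg K₀ hK₀']; norm_num)
  have : @IsGalois ℚ _ (candidateField (q K₀)) _ (algebra' _) := hgal K₀ hK₀'
  rw [← hdeg K₀ hK₀']
  refine card_le_two_pow_of_forall_le _ fun K hK ↦ ?_
  obtain ⟨hK, hqK⟩ := Finset.mem_filter.1 hK
  exact hqK ▸ hle K (hfin.mem_toFinset.1 hK)

end GaloisAction

/-- For `G` the transitive subgroup `6T14 ≅ PGL₂(𝔽₅)` of `S₆`
(the unique transitive subgroup of order `120`, not contained in `A₆`),
`F₆(X;G) ≪_ε X^{E+ε}` with `E = 2 − 1 − 1/10 + √(6/120) + 6/20`. -/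
theorem enumerative_galois_6T14 (G : Subgroup (Equiv.Perm (Fin 6)))
    (htrans : IsTransitiveSub G) (hcard : Nat.card G = 120)
    (hodd : ¬ G ≤ alternatingGroup (Fin 6))
    (ε : ℝ) (hε : 0 < ε) :
    ∃ c : ℝ, 0 < c ∧ ∀ X : ℝ, 2 ≤ X →
      (FnG 6 X G : ℝ) ≤
        c * X ^ ((2 : ℝ) - 1 - 1 / 10 + Real.sqrt (6 / 120) + 6 / 20 + ε) := by
  have hsqrt : (0.223 : ℝ) ≤ Real.sqrt (6 / 120) := Real.le_sqrt_of_sq_le (by norm_num)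
  obtain ⟨C, hC, hle⟩ := exists_card_quinticCandidates_le
    (D := doubleRootsSets) (k := 6) (fun p hp hp5 ↦ ncard_doubleRootsSets_le hp hp5)
    (c := 10 ^ 7) (θ := (2 : ℝ) - 1 - 1 / 10 + Real.sqrt (6 / 120) + 6 / 20 + ε)
    (by norm_num) (by norm_num at hsqrt ⊢; linarith)
  refine ⟨2 ^ 120 * C, by positivity, fun X hX ↦ ?_⟩
  rw [mul_assoc]
  refine le_trans ?_ (mul_le_mul_of_nonneg_left (hle X (by linarith)) (by positivity))
  exact_mod_cast FnG_le htrans hcard X
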